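/- Let f : ℝⁿ → ℝ be analytic near 0 with f(0) = 0 and ∇f(0) = 0, and let g − f ∈ (f)^{r+2} where (f) is the ideal generated by f in analytic germs and r ≥ 1. Define F(ξ, x) = f(x) + ξ(g − f)(x). Then there exist a neighborhood U of 0 in ℝⁿ, δ > 2, and constants C₁, C₃ > 0 such that C₃|∇F(ξ,x)| ≤ |∇f(x)| ≤ C₁|∇F(ξ,x)| for all x ∈ U and |ξ| < δ, where ∇F denotes the full gradient in (ξ, x). -/

import Mathlib

/-- Norm of the full gradient `∇F(ξ,x) = ((g−f)(x), ∇f(x) + ξ∇(g−f)(x))` of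
`F(ξ,x) = f(x) + ξ(g−f)(x)`. -/
noncomputable def nGradF {n : ℕ} (f g : EuclideanSpace ℝ (Fin n) → ℝ) (ξ : ℝ)
    (x : EuclideanSpace ℝ (Fin n)) : ℝ :=
  Real.sqrt ((g x - f x) ^ 2 + ‖gradient f x + ξ • gradient (fun y => g y - f y) x‖ ^ 2)

section LojaAll
open Filter Topology Set Metric
set_option linter.unusedSectionVars false


section Loja

/-- A function is holomorphic near the origin. -/
def HolZ {E : Type} [NormedAddCommGroup E] [NormedSpace ℂ E] (f : E → ℂ) : Prop :=
  ∀ᶠ x in 𝓝 (0 : E), DifferentiableAt ℂ f x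

variable {E : Type} [NormedAddCommGroup E] [NormedSpace ℂ E]

theorem loja_tsum {f : ℕ → E → ℂ} {u : ℕ → ℝ} {R : ℝ} (hR : 0 < R) (hu : Summable u)
    (hd : ∀ k, DifferentiableOn ℂ (f k) (ball 0 R)) (hb : ∀ k, ∀ x ∈ ball (0 : E) R, ‖f k x‖ ≤ u k) :
    ∀ x ∈ ball (0 : E) (R / 2), DifferentiableAt ℂ (fun x => ∑' k, f k x) x := by
  intro x hx
  let _ : NormedSpace ℝ E := NormedSpace.restrictScalars ℝ ℂ E
  have hsub : ball (0 : E) (R / 2) ⊆ ball 0 R := ball_subset_ball (by linarith)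
  have h0 : (0 : E) ∈ ball (0 : E) (R / 2) := mem_ball_self (by linarith)
  refine (hasFDerivAt_tsum_of_isPreconnected (f := f) (f' := fun k x => fderiv ℂ (f k) x)
    (u := fun k => (2 * u k) / (R / 2)) (s := ball (0 : E) (R / 2)) (x₀ := 0)
    ?_ isOpen_ball (convex_ball _ _).isPreconnected ?_ ?_ h0 ?_ hx).differentiableAt
  · exact (hu.mul_left 2).div_const _
  · intro k y hy
    exact ((hd k).differentiableAt (isOpen_ball.mem_nhds (hsub hy))).hasFDerivAt
  · intro k y hy
    have hs2 : ball y (R / 2) ⊆ ball 0 R := by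
      apply ball_subset_ball'
      have := mem_ball.1 hy
      linarith
    refine Complex.norm_fderiv_le_div_of_mapsTo_ball ((hd k).mono hs2) ?_ (by linarith)
    intro w hw
    rw [mem_closedBall, dist_eq_norm]
    have h1 := hb k w (hs2 hw)
    have h2 := hb k y (hsub hy)
    calc _ ≤ ‖f k w‖ + ‖f k y‖ := norm_sub_le _ _
      _ ≤ _ := by linarith
  · exact Summable.of_norm_bounded hu (fun k => hb k 0 (hsub h0))

theorem loja_param [FiniteDimensional ℂ E] {Φ : E → ℝ → ℂ} {x₀ : E} {R M : ℝ} (hR : 0 < R)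
    (hd : ∀ θ, DifferentiableOn ℂ (fun x => Φ x θ) (ball x₀ R))
    (hb : ∀ θ, ∀ x ∈ ball x₀ R, ‖Φ x θ‖ ≤ M)
    (hc : ∀ x ∈ ball x₀ R, Continuous (Φ x)) :
    DifferentiableAt ℂ (fun x => ∫ θ in (0 : ℝ)..(2 * Real.pi), Φ x θ) x₀ := by
  have hx0 : x₀ ∈ ball x₀ R := mem_ball_self hR
  have hmeas : ∀ v : E, MeasureTheory.StronglyMeasurable
      (fun θ => fderiv ℂ (fun x => Φ x θ) x₀ v) := by
    intro v
    obtain ⟨N, hN⟩ : ∃ N : ℕ, ∀ n ≥ N, x₀ + ((n : ℂ) + 1)⁻¹ • v ∈ ball x₀ R := by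
      have h1 : Tendsto (fun n : ℕ => x₀ + ((n : ℂ) + 1)⁻¹ • v) atTop (𝓝 (x₀ + (0 : ℂ) • v)) := by
        have := tendsto_one_div_add_atTop_nhds_zero_nat (𝕜 := ℂ)
        simp only [one_div] at this
        exact (this.smul_const v).const_add _
      rw [zero_smul, add_zero] at h1
      exact eventually_atTop.1 (h1.eventually (isOpen_ball.mem_nhds hx0))
    refine stronglyMeasurable_of_tendsto (f := fun (n : ℕ) θ =>
      (((n + N : ℕ) : ℂ) + 1) • (Φ (x₀ + (((n + N : ℕ) : ℂ) + 1)⁻¹ • v) θ - Φ x₀ θ)) atTop ?_ ?_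
    · intro n
      have h1 := hc _ (hN (n + N) (by omega))
      have h2 := hc _ hx0
      simp only [smul_eq_mul]
      exact (continuous_const.mul (h1.sub h2)).stronglyMeasurable
    · rw [tendsto_pi_nhds]
      intro θ
      have hfd := ((hd θ).differentiableAt (isOpen_ball.mem_nhds hx0)).hasFDerivAt
      refine hfd.lim v (c := fun n : ℕ => (((n + N : ℕ) : ℂ) + 1)) ?_
      have h1 : ∀ n : ℕ, ‖(((n + N : ℕ) : ℂ) + 1)‖ = ((n + N : ℕ) : ℝ) + 1 := by
        intro n
        have : (((n + N : ℕ) : ℂ) + 1) = (((n + N + 1 : ℕ)) : ℂ) := by push_cast; ring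
        rw [this, Complex.norm_natCast]; push_cast; ring
      simp only [h1]
      exact tendsto_atTop_add_const_right _ _
        ((tendsto_natCast_atTop_atTop).comp (tendsto_add_atTop_nat N))
  have hsub : ball x₀ (R / 2) ⊆ ball x₀ R := ball_subset_ball (by linarith)
  refine (intervalIntegral.hasFDerivAt_integral_of_dominated_of_fderiv_le
    (F := Φ) (F' := fun x θ => fderiv ℂ (fun x => Φ x θ) x) (s := ball x₀ (R / 2))
    (bound := fun _ => (2 * M) / (R / 2)) (ball_mem_nhds _ (by linarith)) ?_ ?_ ?_ ?_ ?_ ?_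
    ).differentiableAt
  · filter_upwards [ball_mem_nhds x₀ hR] with x hx
    exact (hc x hx).aestronglyMeasurable
  · exact (hc x₀ hx0).intervalIntegrable _ _
  · let b := Module.finBasis ℂ E
    have : (fun θ => fderiv ℂ (fun x => Φ x θ) x₀) = fun θ =>
        ∑ i, (fderiv ℂ (fun x => Φ x θ) x₀ (b i)) • (LinearMap.toContinuousLinearMap (b.coord i)) := by
      funext θ
      apply ContinuousLinearMap.ext
      intro v
      conv_lhs => rw [← b.sum_repr v, map_sum]
      simp only [map_smul, smul_eq_mul, ContinuousLinearMap.sum_apply,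
        ContinuousLinearMap.smul_apply, LinearMap.coe_toContinuousLinearMap',
        Module.Basis.coord_apply, mul_comm]
    rw [this]
    refine MeasureTheory.StronglyMeasurable.aestronglyMeasurable ?_
    refine Finset.stronglyMeasurable_fun_sum _ (fun i _ => ?_)
    exact (hmeas (b i)).smul_const _
  · refine Eventually.of_forall (fun θ _ x hx => ?_)
    have hs2 : ball x (R / 2) ⊆ ball x₀ R := by
      apply ball_subset_ball'
      have := mem_ball.1 hx
      linarith
    refine Complex.norm_fderiv_le_div_of_mapsTo_ball ((hd θ).mono hs2) ?_ (by linarith)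
    intro w hw
    rw [mem_closedBall, dist_eq_norm]
    have h1 := hb θ w (hs2 hw)
    have h2 := hb θ x (hsub hx)
    calc _ ≤ ‖Φ w θ‖ + ‖Φ x θ‖ := norm_sub_le _ _
      _ ≤ _ := by linarith
  · exact intervalIntegrable_const
  · refine Eventually.of_forall (fun θ _ x hx => ?_)
    exact ((hd θ).differentiableAt (isOpen_ball.mem_nhds (hsub hx))).hasFDerivAt

/-- one step division by the last variable -/
noncomputable def ldel (h : E × ℂ → ℂ) : E × ℂ → ℂ :=
  fun p => dslope (fun w => h (p.1, w)) 0 p.2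

theorem ldel_eq (h : E × ℂ → ℂ) (p : E × ℂ) : h p = h (p.1, 0) + p.2 * ldel h p := by
  have := sub_smul_dslope (fun w => h (p.1, w)) 0 p.2
  simp only [sub_zero, smul_eq_mul] at this
  rw [ldel, this]; ring

theorem ldel_slice {h : E × ℂ → ℂ} {R ρ : ℝ}
    (hd : DifferentiableOn ℂ h (ball (0 : E) R ×ˢ ball (0 : ℂ) ρ)) {y : E} (hy : y ∈ ball (0 : E) R) :
    DifferentiableOn ℂ (fun w => h (y, w)) (ball 0 ρ) := by
  refine hd.comp (f := fun w : ℂ => (y, w)) ?_ (fun w hw => ⟨hy, hw⟩)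
  fun_prop

theorem ldel_bound {h : E × ℂ → ℂ} {R ρ M : ℝ}
    (hd : DifferentiableOn ℂ h (ball (0 : E) R ×ˢ ball (0 : ℂ) ρ))
    (hb : ∀ p ∈ ball (0 : E) R ×ˢ ball (0 : ℂ) ρ, ‖h p‖ ≤ M) :
    ∀ p ∈ ball (0 : E) R ×ˢ ball (0 : ℂ) ρ, ‖ldel h p‖ ≤ 2 / ρ * M := by
  rintro ⟨y, z⟩ ⟨hy, hz⟩
  have hρ : 0 < ρ := pos_of_mem_ball hz
  have := Complex.norm_dslope_le_div_of_mapsTo_ball (R₂ := 2 * M) (ldel_slice hd hy) ?_ hz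
  · calc _ ≤ _ := this
      _ = _ := by ring
  · intro w hw
    rw [mem_closedBall, dist_eq_norm]
    have h1 := hb (y, w) ⟨hy, hw⟩
    have h2 := hb (y, 0) ⟨hy, mem_ball_self hρ⟩
    calc _ ≤ ‖h (y, w)‖ + ‖h (y, 0)‖ := norm_sub_le _ _
      _ ≤ _ := by linarith

theorem ldel_diff [FiniteDimensional ℂ E] {h : E × ℂ → ℂ} {R ρ M : ℝ}
    (hd : DifferentiableOn ℂ h (ball (0 : E) R ×ˢ ball (0 : ℂ) ρ))
    (hb : ∀ p ∈ ball (0 : E) R ×ˢ ball (0 : ℂ) ρ, ‖h p‖ ≤ M) :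
    DifferentiableOn ℂ (ldel h) (ball (0 : E) R ×ˢ ball (0 : ℂ) ρ) := by
  rintro ⟨y₀, z₀⟩ ⟨hy₀, hz₀⟩
  apply DifferentiableAt.differentiableWithinAt
  have hρ : 0 < ρ := pos_of_mem_ball hz₀
  have hz₀' : ‖z₀‖ < ρ := by simpa using hz₀
  have hy₀' : ‖y₀‖ < R := by simpa using hy₀
  have hkb := ldel_bound hd hb
  obtain ⟨r, hr1, hr2⟩ := exists_between hz₀'
  have hr0 : 0 < r := lt_of_le_of_lt (norm_nonneg _) hr1
  set η := min ((r - ‖z₀‖) / 2) (R - ‖y₀‖) with hη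
  have hη0 : 0 < η := lt_min (by linarith) (by linarith)
  have hball : ∀ p ∈ ball ((y₀, z₀) : E × ℂ) η, ‖p.1‖ < R ∧ ‖p.2‖ + (r - ‖z₀‖) / 2 < r := by
    intro p hp
    rw [mem_ball, Prod.dist_eq, max_lt_iff, dist_eq_norm, dist_eq_norm] at hp
    have h1 : ‖p.1‖ ≤ ‖y₀‖ + ‖p.1 - y₀‖ := norm_le_norm_add_norm_sub' _ _
    have h2 : ‖p.2‖ ≤ ‖z₀‖ + ‖p.2 - z₀‖ := norm_le_norm_add_norm_sub' _ _
    have h3 : η ≤ (r - ‖z₀‖) / 2 := min_le_left _ _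
    have h4 : η ≤ R - ‖y₀‖ := min_le_right _ _
    simp only at hp
    constructor <;> linarith [hp.1, hp.2]
  have hcirc : ∀ θ, circleMap 0 r θ ∈ ball (0 : ℂ) ρ := by
    intro θ; simp [abs_of_pos hr0, hr2]
  have hcirc0 : ∀ θ, circleMap 0 r θ ≠ 0 := fun θ => circleMap_ne_center hr0.ne'
  have hsep : ∀ p ∈ ball ((y₀, z₀) : E × ℂ) η, ∀ θ, (r - ‖z₀‖) / 2 ≤ ‖circleMap 0 r θ - p.2‖ := by
    intro p hp θ
    have h1 := (hball p hp).2
    have h2 : ‖circleMap 0 r θ‖ - ‖p.2‖ ≤ ‖circleMap 0 r θ - p.2‖ := norm_sub_norm_le _ _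
    have h3 : ‖circleMap 0 r θ‖ = r := by simp [abs_of_pos hr0]
    linarith
  have hsep0 : ∀ p ∈ ball ((y₀, z₀) : E × ℂ) η, ∀ θ, circleMap 0 r θ - p.2 ≠ 0 := by
    intro p hp θ h0
    have := hsep p hp θ
    rw [h0, norm_zero] at this
    linarith
  have key := loja_param (Φ := fun (p : E × ℂ) θ => (2 * Real.pi * Complex.I : ℂ)⁻¹ *
      (deriv (circleMap 0 r) θ * ((circleMap 0 r θ - p.2)⁻¹ * ldel h (p.1, circleMap 0 r θ))))
      (x₀ := (y₀, z₀)) (R := η)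
      (M := ‖(2 * Real.pi * Complex.I : ℂ)⁻¹‖ * (r * (((r - ‖z₀‖) / 2)⁻¹ * (2 / ρ * M)))) hη0
      ?_ ?_ ?_
  · refine key.congr_of_eventuallyEq ?_
    filter_upwards [ball_mem_nhds _ hη0] with p hp
    have hp1 : p.1 ∈ ball (0 : E) R := by simpa using (hball p hp).1
    have hp2 : p.2 ∈ ball (0 : ℂ) r := by
      have := (hball p hp).2
      rw [mem_ball_zero_iff]; linarith
    have hsl := ldel_slice hd hp1
    have hk : DifferentiableOn ℂ (dslope (fun w => h (p.1, w)) 0) (ball 0 ρ) :=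
      (Complex.differentiableOn_dslope (ball_mem_nhds _ hρ)).2 hsl
    have hk2 : DiffContOnCl ℂ (dslope (fun w => h (p.1, w)) 0) (ball 0 r) := by
      refine DifferentiableOn.diffContOnCl_ball (U := ball 0 ρ) hk ?_
      exact closedBall_subset_ball hr2
    have := hk2.two_pi_i_inv_smul_circleIntegral_sub_inv_smul hp2
    rw [circleIntegral] at this
    rw [intervalIntegral.integral_const_mul]
    simp only [smul_eq_mul] at this
    exact this.symm
  · intro θ
    intro p hp
    apply DifferentiableAt.differentiableWithinAt
    have hp1 : p.1 ∈ ball (0 : E) R := by simpa using (hball p hp).1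
    refine DifferentiableAt.const_mul (DifferentiableAt.const_mul (DifferentiableAt.mul ?_ ?_) _) _
    · exact DifferentiableAt.inv (by fun_prop) (hsep0 p hp θ)
    · have hform : (fun p : E × ℂ => ldel h (p.1, circleMap 0 r θ)) = fun p : E × ℂ =>
          (circleMap 0 r θ)⁻¹ * (h (p.1, circleMap 0 r θ) - h (p.1, 0)) := by
        funext p
        have := ldel_eq h (p.1, circleMap 0 r θ)
        simp only at this
        rw [this]
        field_simp [hcirc0 θ]
        ring
      rw [hform]
      have hop : IsOpen (ball (0 : E) R ×ˢ ball (0 : ℂ) ρ) := isOpen_ball.prod isOpen_ball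
      refine DifferentiableAt.const_mul (DifferentiableAt.sub ?_ ?_) _
      · refine DifferentiableAt.comp p (f := fun p : E × ℂ => (p.1, circleMap 0 r θ)) (g := h) ?_
          (by fun_prop)
        exact hd.differentiableAt (hop.mem_nhds ⟨hp1, hcirc θ⟩)
      · refine DifferentiableAt.comp p (f := fun p : E × ℂ => (p.1, (0 : ℂ))) (g := h) ?_
          (by fun_prop)
        exact hd.differentiableAt (hop.mem_nhds ⟨hp1, mem_ball_self hρ⟩)
  · intro θ p hp
    have hp1 : p.1 ∈ ball (0 : E) R := by simpa using (hball p hp).1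
    rw [norm_mul, norm_mul, norm_mul]
    have h1 : ‖deriv (circleMap 0 r) θ‖ = r := by simp [deriv_circleMap, abs_of_pos hr0]
    rw [h1, norm_inv (circleMap 0 r θ - p.2)]
    have h2 := hkb (p.1, circleMap 0 r θ) ⟨hp1, hcirc θ⟩
    have h3 : ‖circleMap 0 r θ - p.2‖⁻¹ ≤ ((r - ‖z₀‖) / 2)⁻¹ :=
      inv_anti₀ (by linarith) (hsep p hp θ)
    gcongr
  · intro p hp
    have hp1 : p.1 ∈ ball (0 : E) R := by simpa using (hball p hp).1
    have hsl := ldel_slice hd hp1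
    have hk : DifferentiableOn ℂ (dslope (fun w => h (p.1, w)) 0) (ball 0 ρ) :=
      (Complex.differentiableOn_dslope (ball_mem_nhds _ hρ)).2 hsl
    refine continuous_const.mul (Continuous.mul ?_ (Continuous.mul ?_ ?_))
    · have : deriv (circleMap 0 r) = fun θ => circleMap 0 r θ * Complex.I := by
        funext θ; simp
      rw [this]
      fun_prop
    · exact Continuous.inv₀ (by fun_prop) (hsep0 p hp)
    · exact hk.continuousOn.comp_continuous (continuous_circleMap 0 r) hcirc

end Loja

section Loja
variable {E : Type} [NormedAddCommGroup E] [NormedSpace ℂ E]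

theorem ldel_iter [FiniteDimensional ℂ E] {h : E × ℂ → ℂ} {R ρ M : ℝ}
    (hd : DifferentiableOn ℂ h (ball (0 : E) R ×ˢ ball (0 : ℂ) ρ))
    (hb : ∀ p ∈ ball (0 : E) R ×ˢ ball (0 : ℂ) ρ, ‖h p‖ ≤ M) (j : ℕ) :
    DifferentiableOn ℂ (ldel^[j] h) (ball (0 : E) R ×ˢ ball (0 : ℂ) ρ) ∧
    ∀ p ∈ ball (0 : E) R ×ˢ ball (0 : ℂ) ρ, ‖(ldel^[j] h) p‖ ≤ (2 / ρ) ^ j * M := by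
  induction j with
  | zero => exact ⟨hd, fun p hp => by simpa using hb p hp⟩
  | succ j ih =>
    rw [Function.iterate_succ_apply']
    refine ⟨ldel_diff ih.1 ih.2, ?_⟩
    intro p hp
    have := ldel_bound ih.1 ih.2 p hp
    rw [pow_succ']
    linarith

theorem ldel_iter_eq (h : E × ℂ → ℂ) (p : E × ℂ) (j : ℕ) :
    h p = p.2 ^ j * (ldel^[j] h) p + ∑ i ∈ Finset.range j, (ldel^[i] h) (p.1, 0) * p.2 ^ i := by
  induction j with
  | zero => simp
  | succ j ih =>
    rw [Finset.sum_range_succ, Function.iterate_succ_apply', ih]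
    have := ldel_eq (ldel^[j] h) p
    rw [this]
    ring

theorem wdiv_core [FiniteDimensional ℂ E] {h e : E × ℂ → ℂ} {R ρ M ε : ℝ} (hR : 0 < R) (hρ : 0 < ρ)
    (hε : 0 ≤ ε) (hM : 0 ≤ M) (d : ℕ)
    (hd : DifferentiableOn ℂ h (ball (0 : E) R ×ˢ ball (0 : ℂ) ρ))
    (hb : ∀ p ∈ ball (0 : E) R ×ˢ ball (0 : ℂ) ρ, ‖h p‖ ≤ M)
    (hed : DifferentiableOn ℂ e (ball (0 : E) R ×ˢ ball (0 : ℂ) ρ))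
    (heb : ∀ p ∈ ball (0 : E) R ×ˢ ball (0 : ℂ) ρ, ‖e p‖ ≤ ε)
    (hs : ε * (2 / ρ) ^ d ≤ 1 / 2) :
    ∃ (q : E × ℂ → ℂ) (c : ℕ → E → ℂ), HolZ q ∧ (∀ j, HolZ (c j)) ∧
      ∀ p ∈ ball (0 : E) R ×ˢ ball (0 : ℂ) ρ,
        h p = (p.2 ^ d - e p) * q p + ∑ j ∈ Finset.range d, c j p.1 * p.2 ^ j := by
  let H : ℕ → (E × ℂ → ℂ) := fun k => Nat.rec h (fun _ f => fun p => e p * (ldel^[d] f) p) k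
  have H0 : H 0 = h := rfl
  have Hs : ∀ k, H (k + 1) = fun p => e p * (ldel^[d] (H k)) p := fun k => rfl
  have HB : ∀ k, DifferentiableOn ℂ (H k) (ball (0 : E) R ×ˢ ball (0 : ℂ) ρ) ∧
      ∀ p ∈ ball (0 : E) R ×ˢ ball (0 : ℂ) ρ, ‖H k p‖ ≤ (1 / 2) ^ k * M := by
    intro k
    induction k with
    | zero => exact ⟨hd, fun p hp => by simpa [H0] using hb p hp⟩
    | succ k ih =>
      rw [Hs]
      obtain ⟨h1, h2⟩ := ldel_iter ih.1 ih.2 d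
      refine ⟨hed.mul h1, fun p hp => ?_⟩
      rw [norm_mul]
      calc ‖e p‖ * ‖(ldel^[d] (H k)) p‖ ≤ ε * ((2 / ρ) ^ d * ((1 / 2) ^ k * M)) := by
            gcongr
            · exact heb p hp
            · exact h2 p hp
        _ = (ε * (2 / ρ) ^ d) * ((1 / 2) ^ k * M) := by ring
        _ ≤ (1 / 2) * ((1 / 2) ^ k * M) := by gcongr
        _ = _ := by ring
  have hI : ∀ j k, DifferentiableOn ℂ (ldel^[j] (H k)) (ball (0 : E) R ×ˢ ball (0 : ℂ) ρ) ∧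
    ∀ p ∈ ball (0 : E) R ×ˢ ball (0 : ℂ) ρ, ‖(ldel^[j] (H k)) p‖ ≤ (2 / ρ) ^ j * ((1 / 2) ^ k * M) :=
    fun j k => ldel_iter (HB k).1 (HB k).2 j
  have hgeo : ∀ j : ℕ, Summable (fun k : ℕ => (2 / ρ) ^ j * ((1 / 2 : ℝ) ^ k * M)) := fun j =>
    ((summable_geometric_of_lt_one (by norm_num) (by norm_num)).mul_right M).mul_left _
  have hsub : ball (0 : E × ℂ) (min R ρ) ⊆ ball (0 : E) R ×ˢ ball (0 : ℂ) ρ := by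
    intro p hp
    rw [mem_ball, Prod.dist_eq, max_lt_iff] at hp
    exact ⟨lt_of_lt_of_le hp.1 (min_le_left _ _), lt_of_lt_of_le hp.2 (min_le_right _ _)⟩
  refine ⟨fun p => ∑' k, (ldel^[d] (H k)) p, fun j y => ∑' k, (ldel^[j] (H k)) (y, 0), ?_, ?_, ?_⟩
  · have hm : 0 < min R ρ := lt_min hR hρ
    have := loja_tsum (f := fun k => ldel^[d] (H k)) hm (hgeo d)
      (fun k => (hI d k).1.mono hsub) (fun k x hx => (hI d k).2 x (hsub hx))
    filter_upwards [ball_mem_nhds (0 : E × ℂ) (half_pos hm)] with x hx using this x hx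
  · intro j
    have := loja_tsum (f := fun k (y : E) => (ldel^[j] (H k)) (y, 0)) hR (hgeo j)
      (fun k => ?_) (fun k x hx => (hI j k).2 (x, 0) ⟨hx, mem_ball_self hρ⟩)
    · filter_upwards [ball_mem_nhds (0 : E) (half_pos hR)] with x hx using this x hx
    · refine (hI j k).1.comp (f := fun y : E => (y, (0 : ℂ))) (by fun_prop) ?_
      intro y hy
      exact ⟨hy, mem_ball_self hρ⟩
  · intro p hp
    have hp0 : (p.1, (0 : ℂ)) ∈ ball (0 : E) R ×ˢ ball (0 : ℂ) ρ := ⟨hp.1, mem_ball_self hρ⟩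
    have S : ∀ j, ∀ p ∈ ball (0 : E) R ×ˢ ball (0 : ℂ) ρ, Summable (fun k => (ldel^[j] (H k)) p) :=
      fun j p hp => Summable.of_norm_bounded (hgeo j) (fun k => (hI j k).2 p hp)
    have SH : Summable (fun k => H k p) := S 0 p hp
    have hstep : ∀ k, H k p - H (k + 1) p = (p.2 ^ d - e p) * (ldel^[d] (H k)) p +
        ∑ i ∈ Finset.range d, (ldel^[i] (H k)) (p.1, 0) * p.2 ^ i := by
      intro k
      rw [Hs]
      have := ldel_iter_eq (H k) p d
      rw [this]
      ring
    have h1 : ∑' k, (H k p - H (k + 1) p) = h p := by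
      rw [SH.tsum_sub ((summable_nat_add_iff 1).2 SH), SH.tsum_eq_zero_add, H0]
      ring
    have S2 : ∀ i, Summable (fun k => (ldel^[i] (H k)) (p.1, 0) * p.2 ^ i) :=
      fun i => (S i _ hp0).mul_right _
    rw [← h1, tsum_congr hstep, Summable.tsum_add ((S d p hp).mul_left _)
      (summable_sum (fun i _ => S2 i)), tsum_mul_left, Summable.tsum_finsetSum (fun i _ => S2 i)]
    simp only [tsum_mul_right]

theorem wdiv [FiniteDimensional ℂ E] {g h : E × ℂ → ℂ} (hg : HolZ g) (hh : HolZ h) {d : ℕ}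
    {u : ℂ → ℂ} (hu : AnalyticAt ℂ u 0) (hu0 : u 0 ≠ 0)
    (hgu : ∀ᶠ z in 𝓝 (0 : ℂ), g (0, z) = z ^ d * u z) :
    ∃ (q : E × ℂ → ℂ) (c : ℕ → E → ℂ), HolZ q ∧ (∀ j, HolZ (c j)) ∧
      ∀ᶠ p in 𝓝 (0 : E × ℂ), h p = q p * g p + ∑ j ∈ Finset.range d, c j p.1 * p.2 ^ j := by
  have hdiv : ∀ (a b : E × ℂ → ℂ) (p : E × ℂ), DifferentiableAt ℂ a p → DifferentiableAt ℂ b p →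
      b p ≠ 0 → DifferentiableAt ℂ (fun p => a p / b p) p := by
    intro a b p h1 h2 h3
    simp only [div_eq_mul_inv]
    exact h1.mul (DifferentiableAt.inv h2 h3)
  have hud : ∀ᶠ z in 𝓝 (0 : ℂ), DifferentiableAt ℂ u z :=
    Complex.analyticAt_iff_eventually_differentiableAt.1 hu
  have hun : ∀ᶠ z in 𝓝 (0 : ℂ), u z ≠ 0 := hu.continuousAt.eventually_ne hu0
  have hhc : ContinuousAt h 0 := (hh.self_of_nhds).continuousAt
  have hhb : ∀ᶠ p in 𝓝 (0 : E × ℂ), ‖h p‖ < ‖h 0‖ + 1 :=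
    hhc.norm.eventually_lt_const (by linarith)
  obtain ⟨a, ha, hA⟩ := Metric.eventually_nhds_iff_ball.1 (hg.and (hh.and hhb))
  obtain ⟨b, hb, hB⟩ := Metric.eventually_nhds_iff_ball.1 (hud.and (hun.and hgu))
  set ρ := min a b / 2 with hρdef
  have hρ : 0 < ρ := half_pos (lt_min ha hb)
  have hρa : ρ < a := by have := min_le_left a b; have := lt_min ha hb; rw [hρdef]; linarith
  have hρb : ρ < b := by have := min_le_right a b; have := lt_min ha hb; rw [hρdef]; linarith
  have hmem : ∀ p : E × ℂ, ‖p.1‖ < a → ‖p.2‖ < a → p ∈ ball (0 : E × ℂ) a := by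
    intro p h1 h2
    rw [mem_ball, Prod.dist_eq, max_lt_iff]
    simpa using ⟨h1, h2⟩
  let e : E × ℂ → ℂ := fun p => p.2 ^ d - g p / u p.2
  have hed : ∀ p : E × ℂ, ‖p.1‖ < a → ‖p.2‖ < a → ‖p.2‖ < b → DifferentiableAt ℂ e p := by
    intro p h1 h2 h3
    have hgd := (hA p (hmem p h1 h2)).1
    have hB' := hB p.2 (by simpa using h3)
    have hu2 : DifferentiableAt ℂ (fun p : E × ℂ => u p.2) p :=
      DifferentiableAt.comp p (g := u) (f := Prod.snd) hB'.1 (by fun_prop)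
    exact DifferentiableAt.sub (by fun_prop) (hdiv _ _ _ hgd hu2 hB'.2.1)
  set ε : ℝ := 1 / 2 * (ρ / 2) ^ d with hεdef
  have hε : 0 < ε := by positivity
  have htube : ∀ᶠ y in 𝓝 (0 : E), ∀ z ∈ closedBall (0 : ℂ) ρ, ‖e (y, z)‖ < ε := by
    refine (isCompact_closedBall (0 : ℂ) ρ).eventually_forall_of_forall_eventually ?_
    intro z hz
    have hz' : ‖z‖ ≤ ρ := by simpa using hz
    have hc : ContinuousAt e (0, z) :=
      (hed (0, z) (by simpa using ha) (by simpa using by linarith)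
        (by simpa using by linarith)).continuousAt
    have he0 : e (0, z) = 0 := by
      have hB' := hB z (by simpa using by linarith)
      simp only [e]
      rw [hB'.2.2, mul_div_assoc, div_self hB'.2.1]
      ring
    have := hc.norm.eventually_lt_const (u := ε) (by change ‖e (0, z)‖ < ε; rw [he0]; simpa using hε)
    simpa using this
  obtain ⟨R', hR', hRt⟩ := Metric.eventually_nhds_iff_ball.1 htube
  set R := min R' a with hRdef
  have hR : 0 < R := lt_min hR' ha
  have hΩ : ∀ p ∈ ball (0 : E) R ×ˢ ball (0 : ℂ) ρ, ‖p.1‖ < a ∧ ‖p.2‖ < ρ ∧ p.1 ∈ ball 0 R' := by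
    rintro p ⟨h1, h2⟩
    have h1' : ‖p.1‖ < R := by simpa using h1
    have h2' : ‖p.2‖ < ρ := by simpa using h2
    exact ⟨lt_of_lt_of_le h1' (min_le_right _ _), h2',
      by simpa using lt_of_lt_of_le h1' (min_le_left _ _)⟩
  obtain ⟨q, c, hq, hc, hqc⟩ := wdiv_core (h := h) (e := e) (M := ‖h 0‖ + 1) hR hρ hε.le
    (by positivity) d
    (fun p hp => (hA p (hmem p (hΩ p hp).1 ((hΩ p hp).2.1.trans hρa))).2.1.differentiableWithinAt)
    (fun p hp => (hA p (hmem p (hΩ p hp).1 ((hΩ p hp).2.1.trans hρa))).2.2.le)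
    (fun p hp => (hed p (hΩ p hp).1 ((hΩ p hp).2.1.trans hρa)
      ((hΩ p hp).2.1.trans hρb)).differentiableWithinAt)
    (fun p hp => (hRt p.1 (hΩ p hp).2.2 p.2 (by simpa using (hΩ p hp).2.1.le)).le)
    (by
      rw [hεdef, mul_assoc, ← mul_pow]
      have : ρ / 2 * (2 / ρ) = 1 := by field_simp
      rw [this]; simp)
  refine ⟨fun p => q p / u p.2, c, ?_, hc, ?_⟩
  · have hsnd : Tendsto (Prod.snd : E × ℂ → ℂ) (𝓝 0) (𝓝 0) := continuous_snd.tendsto' _ _ rfl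
    filter_upwards [hq, hsnd.eventually hud, hsnd.eventually hun] with p h1 h2 h3
    have hu2 : DifferentiableAt ℂ (fun p : E × ℂ => u p.2) p :=
      DifferentiableAt.comp p (g := u) (f := Prod.snd) h2 (by fun_prop)
    exact hdiv _ _ _ h1 hu2 h3
  · have : ball (0 : E) R ×ˢ ball (0 : ℂ) ρ ∈ 𝓝 (0 : E × ℂ) :=
      prod_mem_nhds (ball_mem_nhds _ hR) (ball_mem_nhds _ hρ)
    filter_upwards [this] with p hp
    rw [hqc p hp]
    simp only [e]
    ring

end Loja

section Loja
variable {E : Type} [NormedAddCommGroup E] [NormedSpace ℂ E]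

theorem HolZ.continuousAt {f : E → ℂ} (hf : HolZ f) : ContinuousAt f 0 :=
  hf.self_of_nhds.continuousAt

theorem HolZ.analyticAt {f : ℂ → ℂ} (hf : HolZ f) : AnalyticAt ℂ f 0 :=
  Complex.analyticAt_iff_eventually_differentiableAt.2 hf

theorem AnalyticAt.holZ {f : E → ℂ} (hf : AnalyticAt ℂ f 0) : HolZ f :=
  hf.eventually_analyticAt.mono fun _ h => h.differentiableAt

theorem HolZ.comp' {F : Type} [NormedAddCommGroup F] [NormedSpace ℂ F] {f : E → ℂ} (hf : HolZ f)
    {φ : F → E} (hφ : ∀ᶠ x in 𝓝 (0 : F), DifferentiableAt ℂ φ x) (h0 : φ 0 = 0) :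
    HolZ (fun x => f (φ x)) := by
  have hc : Tendsto φ (𝓝 0) (𝓝 0) := by
    have := hφ.self_of_nhds.continuousAt.tendsto
    rwa [h0] at this
  filter_upwards [hφ, hc.eventually hf] with x h1 h2
  exact h2.comp x h1

/-- The algebra of functions holomorphic near the origin. -/
def holAlg (E : Type) [NormedAddCommGroup E] [NormedSpace ℂ E] : Subalgebra ℂ (E → ℂ) where
  carrier := {f | HolZ f}
  mul_mem' := fun {a b} ha hb => by
    filter_upwards [ha, hb] with x h1 h2 using h1.mul h2
  add_mem' := fun {a b} ha hb => by
    filter_upwards [ha, hb] with x h1 h2 using h1.add h2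
  algebraMap_mem' := fun r => Eventually.of_forall fun x =>
    (differentiableAt_const r : DifferentiableAt ℂ (fun _ : E => r) x)

theorem mem_holAlg {f : E → ℂ} : f ∈ holAlg E ↔ HolZ f := Iff.rfl

theorem poly_eq_zero_of_pow {P : Polynomial ℂ} {d : ℕ} {k : ℂ → ℂ} (hk : ContinuousAt k 0)
    (h : ∀ᶠ z in 𝓝[≠] (0 : ℂ), P.eval z = z ^ d * k z) : ∀ j < d, P.coeff j = 0 := by
  intro j
  induction j using Nat.strong_induction_on with
  | _ j ih =>
    intro hj
    obtain ⟨r, hr⟩ := Polynomial.X_pow_dvd_iff.2 (fun i hi => ih i hi (hi.trans hj))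
    have hc : P.coeff j = r.eval 0 := by
      rw [hr, Polynomial.coeff_X_pow_mul', if_pos le_rfl, Nat.sub_self,
        Polynomial.coeff_zero_eq_eval_zero]
    rw [hc]
    have h1 : ∀ᶠ z in 𝓝[≠] (0 : ℂ), r.eval z = z ^ (d - j) * k z := by
      filter_upwards [h, self_mem_nhdsWithin] with z hz hz0
      have hz0' : z ≠ 0 := hz0
      rw [hr, Polynomial.eval_mul, Polynomial.eval_pow, Polynomial.eval_X] at hz
      have : z ^ d = z ^ j * z ^ (d - j) := by rw [← pow_add]; congr 1; omega
      rw [this, mul_assoc] at hz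
      exact mul_left_cancel₀ (pow_ne_zero _ hz0') hz
    have t1 : Tendsto (fun z => r.eval z) (𝓝[≠] (0 : ℂ)) (𝓝 (r.eval 0)) :=
      (r.continuous.tendsto 0).mono_left nhdsWithin_le_nhds
    have t2 : Tendsto (fun z => z ^ (d - j) * k z) (𝓝[≠] (0 : ℂ)) (𝓝 ((0 : ℂ) ^ (d - j) * k 0)) :=
      (((continuous_pow (d - j)).continuousAt (x := (0 : ℂ))).mul hk).tendsto.mono_left
        nhdsWithin_le_nhds
    rw [zero_pow (by omega), zero_mul] at t2
    exact tendsto_nhds_unique (t1.congr' h1) t2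

theorem wprep [FiniteDimensional ℂ E] {g : E × ℂ → ℂ} (hg : HolZ g) {d : ℕ}
    {u : ℂ → ℂ} (hu : AnalyticAt ℂ u 0) (hu0 : u 0 ≠ 0)
    (hgu : ∀ᶠ z in 𝓝 (0 : ℂ), g (0, z) = z ^ d * u z) :
    ∃ (q : E × ℂ → ℂ) (c : ℕ → E → ℂ), HolZ q ∧ (∀ j, HolZ (c j)) ∧ q 0 ≠ 0 ∧
      (∀ j < d, c j 0 = 0) ∧
      ∀ᶠ p in 𝓝 (0 : E × ℂ), p.2 ^ d + ∑ j ∈ Finset.range d, c j p.1 * p.2 ^ j = q p * g p := by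
  have hh : HolZ (fun p : E × ℂ => p.2 ^ d) := Eventually.of_forall fun x => by fun_prop
  obtain ⟨q, c, hq, hc, hqc⟩ := wdiv hg hh hu hu0 hgu
  have hi : Tendsto (fun z : ℂ => ((0 : E), z)) (𝓝 0) (𝓝 0) :=
    (by fun_prop : Continuous (fun z : ℂ => ((0 : E), z))).tendsto' _ _ rfl
  have hz : ∀ᶠ z in 𝓝 (0 : ℂ), z ^ d * (1 - q (0, z) * u z) =
      ∑ j ∈ Finset.range d, c j 0 * z ^ j := by
    filter_upwards [hi.eventually hqc, hgu] with z h1 h2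
    simp only [h2] at h1
    linear_combination h1
  have hqc0 : ContinuousAt (fun z => q ((0 : E), z)) 0 :=
    ContinuousAt.comp (f := fun z : ℂ => ((0 : E), z)) (g := q) hq.continuousAt (by fun_prop)
  have hk : ContinuousAt (fun z => 1 - q ((0 : E), z) * u z) 0 :=
    continuousAt_const.sub (hqc0.mul hu.continuousAt)
  let P : Polynomial ℂ := ∑ j ∈ Finset.range d, Polynomial.C (c j 0) * Polynomial.X ^ j
  have hP : ∀ z, P.eval z = ∑ j ∈ Finset.range d, c j 0 * z ^ j := by
    intro z; simp [P, Polynomial.eval_finsetSum]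
  have hP0 := poly_eq_zero_of_pow (P := P) (d := d) hk (by
    filter_upwards [hz.filter_mono nhdsWithin_le_nhds] with z h1
    rw [hP, h1])
  have hc0 : ∀ j < d, c j 0 = 0 := by
    intro j hj
    rw [← hP0 j hj]
    simp [P, Polynomial.coeff_C_mul, Polynomial.coeff_X_pow]
    intro h; omega
  have hq0 : 1 - q 0 * u 0 = 0 := by
    have h1 : ∀ᶠ z in 𝓝[≠] (0 : ℂ), 1 - q ((0 : E), z) * u z = 0 := by
      filter_upwards [hz.filter_mono nhdsWithin_le_nhds, self_mem_nhdsWithin] with z h1 h2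
      rw [Finset.sum_eq_zero (fun j hj => by rw [hc0 j (Finset.mem_range.1 hj), zero_mul])] at h1
      exact (mul_eq_zero.1 h1).resolve_left (pow_ne_zero _ h2)
    exact tendsto_nhds_unique (hk.tendsto.mono_left nhdsWithin_le_nhds)
      (tendsto_const_nhds.congr' (h1.mono fun z hz => hz.symm))
  refine ⟨q, fun j => - c j, hq, fun j => (holAlg E).neg_mem (hc j), ?_, ?_, ?_⟩
  · intro h; rw [h] at hq0; simp at hq0
  · intro j hj; simp [hc0 j hj]
  · filter_upwards [hqc] with p hp
    simp only [Pi.neg_apply, neg_mul, Finset.sum_neg_distrib]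
    rw [hp]; ring

/-- Smallness of roots of monic polynomials. -/
theorem root_small {d : ℕ} {a : ℕ → ℂ} {z : ℂ} {η : ℝ} (hη : 0 < η) (hη1 : η ≤ 1)
    (ha : ∑ j ∈ Finset.range d, ‖a j‖ < η ^ d)
    (hz : z ^ d + ∑ j ∈ Finset.range d, a j * z ^ j = 0) : ‖z‖ < η := by
  by_contra hcon
  push Not at hcon
  have hzpos : 0 < ‖z‖ := hη.trans_le hcon
  have h1 : ‖z‖ ^ d = ‖∑ j ∈ Finset.range d, a j * z ^ j‖ := by
    rw [← norm_pow, eq_neg_of_add_eq_zero_left hz, norm_neg]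
  have h2 : ∀ j ∈ Finset.range d, ‖z‖ ^ j * η ^ d ≤ ‖z‖ ^ d := by
    intro j hj
    have hj' := Finset.mem_range.1 hj
    calc ‖z‖ ^ j * η ^ d ≤ ‖z‖ ^ j * η ^ (d - j) := by
          gcongr ?_ * ?_
          exact pow_le_pow_of_le_one hη.le hη1 (by omega)
      _ ≤ ‖z‖ ^ j * ‖z‖ ^ (d - j) := by gcongr
      _ = _ := by rw [← pow_add]; congr 1; omega
  have h3 : ‖z‖ ^ d * η ^ d ≤ (∑ j ∈ Finset.range d, ‖a j‖) * ‖z‖ ^ d := by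
    calc ‖z‖ ^ d * η ^ d ≤ (∑ j ∈ Finset.range d, ‖a j * z ^ j‖) * η ^ d := by
          gcongr; rw [h1]; exact norm_sum_le _ _
      _ = ∑ j ∈ Finset.range d, ‖a j‖ * (‖z‖ ^ j * η ^ d) := by
          rw [Finset.sum_mul]; refine Finset.sum_congr rfl fun j _ => ?_
          rw [norm_mul, norm_pow]; ring
      _ ≤ ∑ j ∈ Finset.range d, ‖a j‖ * ‖z‖ ^ d :=
          Finset.sum_le_sum fun j hj => by gcongr; exact h2 j hj
      _ = _ := by rw [Finset.sum_mul]
  have h4 : 0 < ‖z‖ ^ d := by positivity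
  nlinarith

end Loja

section Loja

/-- Monic polynomial with given lower coefficients. -/
noncomputable def mpol (d : ℕ) (a : ℕ → ℂ) (z : ℂ) : ℂ := z ^ d + ∑ j ∈ Finset.range d, a j * z ^ j

theorem root_bound {d : ℕ} (hd : 1 ≤ d) {a : ℕ → ℂ} {z : ℂ} {A : ℝ}
    (ha : ∑ j ∈ Finset.range d, ‖a j‖ ≤ A) (hz : mpol d a z = 0) : ‖z‖ ≤ 1 + A := by
  have hA : 0 ≤ A := le_trans (Finset.sum_nonneg fun _ _ => norm_nonneg _) ha
  by_contra hcon
  push Not at hcon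
  have hz1 : 1 ≤ ‖z‖ := by linarith
  obtain ⟨k, rfl⟩ : ∃ k, d = k + 1 := ⟨d - 1, by omega⟩
  have h1 : ‖z‖ ^ (k + 1) = ‖∑ j ∈ Finset.range (k + 1), a j * z ^ j‖ := by
    rw [← norm_pow, eq_neg_of_add_eq_zero_left hz, norm_neg]
  have h2 : ‖z‖ ^ (k + 1) ≤ A * ‖z‖ ^ k := by
    rw [h1]
    calc _ ≤ ∑ j ∈ Finset.range (k + 1), ‖a j * z ^ j‖ := norm_sum_le _ _
      _ ≤ ∑ j ∈ Finset.range (k + 1), ‖a j‖ * ‖z‖ ^ k := by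
          refine Finset.sum_le_sum fun j hj => ?_
          rw [norm_mul, norm_pow]
          have := Finset.mem_range.1 hj
          gcongr
          omega
      _ = (∑ j ∈ Finset.range (k + 1), ‖a j‖) * ‖z‖ ^ k := by rw [Finset.sum_mul]
      _ ≤ _ := by gcongr
  have h4 : 0 < ‖z‖ ^ k := by positivity
  rw [pow_succ'] at h2
  have := le_of_mul_le_mul_right h2 h4
  linarith

/-- Coefficients after the shift `z ↦ z + b`. -/
noncomputable def shiftc (d : ℕ) (a : ℕ → ℂ) (b : ℂ) (k : ℕ) : ℂ :=
  b ^ (d - k) * (d.choose k : ℂ) + ∑ j ∈ Finset.range d, a j * (b ^ (j - k) * (j.choose k : ℂ))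

theorem mpol_shift (d : ℕ) (a : ℕ → ℂ) (b z : ℂ) :
    mpol d a (z + b) = mpol d (shiftc d a b) z := by
  have hj : ∀ j ∈ Finset.range d, (z + b) ^ j =
      ∑ k ∈ Finset.range d, z ^ k * (b ^ (j - k) * (j.choose k : ℂ)) := by
    intro j hj
    have hj' := Finset.mem_range.1 hj
    rw [add_pow]
    rw [← Finset.sum_subset (s₁ := Finset.range (j + 1)) (s₂ := Finset.range d)]
    · exact Finset.sum_congr rfl fun k _ => by ring
    · intro k hk; rw [Finset.mem_range] at *; omega
    · intro k _ hk
      rw [Finset.mem_range] at hk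
      rw [Nat.choose_eq_zero_of_lt (by omega)]; simp
  unfold mpol shiftc
  rw [add_pow, Finset.sum_range_succ]
  simp only [Finset.sum_congr rfl (fun j hj' => by rw [hj j hj'] :
    ∀ j ∈ Finset.range d, a j * (z + b) ^ j = a j * _), add_mul, Finset.sum_add_distrib]
  have : ∑ j ∈ Finset.range d, a j * ∑ k ∈ Finset.range d, z ^ k * (b ^ (j - k) * (j.choose k : ℂ))
      = ∑ k ∈ Finset.range d, (∑ j ∈ Finset.range d, a j * (b ^ (j - k) * (j.choose k : ℂ))) * z ^ k := by
    simp only [Finset.mul_sum, Finset.sum_mul]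
    rw [Finset.sum_comm]
    exact Finset.sum_congr rfl fun k _ => Finset.sum_congr rfl fun j _ => by ring
  rw [this]
  have h2 : ∑ k ∈ Finset.range d, z ^ k * b ^ (d - k) * (d.choose k : ℂ) =
      ∑ k ∈ Finset.range d, b ^ (d - k) * (d.choose k : ℂ) * z ^ k :=
    Finset.sum_congr rfl fun k _ => by ring
  rw [h2]
  simp
  ring

theorem shiftc_top (d : ℕ) (hd : 1 ≤ d) (a : ℕ → ℂ) :
    shiftc d a (- a (d - 1) / d) (d - 1) = 0 := by
  unfold shiftc
  obtain ⟨k, rfl⟩ : ∃ k, d = k + 1 := ⟨d - 1, by omega⟩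
  simp only [Nat.add_sub_cancel]
  rw [Finset.sum_range_succ, Finset.sum_eq_zero]
  · have : ((k : ℂ) + 1) ≠ 0 := by exact_mod_cast Nat.succ_ne_zero k
    simp
    field_simp
    ring
  · intro j hj
    rw [Finset.mem_range] at hj
    rw [Nat.choose_eq_zero_of_lt hj]; simp

theorem shiftc_zero (d : ℕ) (a : ℕ → ℂ) (ha : ∀ j < d, a j = 0) (k : ℕ) (hk : k < d) :
    shiftc d a 0 k = 0 := by
  unfold shiftc
  rw [zero_pow (by omega), Finset.sum_eq_zero]
  · simp
  · intro j hj; rw [ha j (Finset.mem_range.1 hj)]; simp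

/-- Newton polygon step. -/
theorem newton {d : ℕ} {c : ℕ → ℂ → ℂ} (hc : ∀ j, AnalyticAt ℂ (c j) 0) (hc0 : ∀ j < d, c j 0 = 0)
    (hne : ∃ j < d, ¬ ∀ᶠ t in 𝓝 (0 : ℂ), c j t = 0) :
    ∃ (q p : ℕ) (c' : ℕ → ℂ → ℂ), 1 ≤ q ∧ 1 ≤ p ∧ (∀ j, AnalyticAt ℂ (c' j) 0) ∧
      (∃ j < d, c' j 0 ≠ 0) ∧ (∀ j, (∀ᶠ t in 𝓝 (0 : ℂ), c j t = 0) → c' j 0 = 0) ∧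
      ∀ j < d, ∀ᶠ s in 𝓝 (0 : ℂ), c j (s ^ q) * s ^ (p * j) = s ^ (p * d) * c' j s := by
  classical
  have key : ∀ j, ¬ (∀ᶠ t in 𝓝 (0 : ℂ), c j t = 0) → ∃ (m : ℕ) (u : ℂ → ℂ), AnalyticAt ℂ u 0 ∧
      u 0 ≠ 0 ∧ ∀ᶠ t in 𝓝 (0 : ℂ), c j t = t ^ m * u t := by
    intro j hj
    obtain ⟨m, u, hu, hu0, h⟩ := (hc j).exists_eventuallyEq_pow_smul_nonzero_iff.2 hj
    exact ⟨m, u, hu, hu0, by simpa using h⟩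
  choose! m u hu hu0 hmu using key
  let J := (Finset.range d).filter (fun j => ¬ ∀ᶠ t in 𝓝 (0 : ℂ), c j t = 0)
  have hJ : J.Nonempty := by
    obtain ⟨j, hj, h⟩ := hne
    exact ⟨j, by simp only [J, Finset.mem_filter, Finset.mem_range]; exact ⟨hj, h⟩⟩
  obtain ⟨j0, hj0, hmin⟩ := J.exists_min_image (fun j => (m j : ℚ) / ((d - j : ℕ) : ℚ)) hJ
  simp only [J, Finset.mem_filter, Finset.mem_range] at hj0 hmin
  have hq : 1 ≤ d - j0 := by omega
  have hmin' : ∀ j, j < d → (¬ ∀ᶠ t in 𝓝 (0 : ℂ), c j t = 0) → m j0 * (d - j) ≤ m j * (d - j0) := by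
    intro j hj h
    have h1 := hmin j ⟨hj, h⟩
    have a1 : (0 : ℚ) < ((d - j0 : ℕ) : ℚ) := by exact_mod_cast hq
    have a2 : (0 : ℚ) < ((d - j : ℕ) : ℚ) := by exact_mod_cast (by omega : 0 < d - j)
    rw [div_le_div_iff₀ a1 a2] at h1
    exact_mod_cast h1
  have hp : 1 ≤ m j0 := by
    rcases Nat.eq_zero_or_pos (m j0) with h | h
    · exfalso
      have := (hmu j0 hj0.2).self_of_nhds
      rw [h, hc0 j0 hj0.1] at this
      exact hu0 j0 hj0.2 (by simpa using this.symm)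
    · exact h
  have hpow : Tendsto (fun s : ℂ => s ^ (d - j0)) (𝓝 0) (𝓝 0) :=
    (continuous_pow _).tendsto' _ _ (by simp; omega)
  refine ⟨d - j0, m j0, fun j s => if (∀ᶠ t in 𝓝 (0 : ℂ), c j t = 0) then 0 else
    s ^ (m j * (d - j0) - m j0 * (d - j)) * u j (s ^ (d - j0)), hq, hp, ?_, ⟨j0, hj0.1, ?_⟩, ?_, ?_⟩
  · intro j
    by_cases h : ∀ᶠ t in 𝓝 (0 : ℂ), c j t = 0
    · simp only [if_pos h]; exact analyticAt_const
    · simp only [if_neg h]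
      refine (analyticAt_id.pow _).mul ?_
      refine AnalyticAt.fun_comp (g := u j) (f := fun s : ℂ => s ^ (d - j0)) ?_ (analyticAt_id.pow _)
      rw [zero_pow (by omega)]; exact hu j h
  · simp only [if_neg hj0.2, Nat.sub_self, pow_zero, one_mul]
    rw [zero_pow (by omega)]
    exact hu0 j0 hj0.2
  · intro j h; simp only [if_pos h]
  · intro j hj
    by_cases h : ∀ᶠ t in 𝓝 (0 : ℂ), c j t = 0
    · simp only [if_pos h]
      filter_upwards [hpow.eventually h] with s hs
      rw [hs]; simp
    · simp only [if_neg h]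
      filter_upwards [hpow.eventually (hmu j h)] with s hs
      rw [hs, ← pow_mul]
      have e : (d - j0) * m j + m j0 * j = m j0 * d + (m j * (d - j0) - m j0 * (d - j)) := by
        have h1 := hmin' j hj h
        obtain ⟨x, hx⟩ : ∃ x, d = j + x := ⟨d - j, by omega⟩
        have h2 : m j0 * d = m j0 * j + m j0 * (d - j) := by rw [← mul_add]; congr 1; omega
        rw [h2, mul_comm (d - j0) (m j)]; omega
      rw [show s ^ ((d - j0) * m j) * u j (s ^ (d - j0)) * s ^ (m j0 * j) =
        s ^ ((d - j0) * m j + m j0 * j) * u j (s ^ (d - j0)) by rw [pow_add]; ring, e, pow_add]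
      ring

end Loja

section Loja

/-- Conclusion of the Puiseux theorem. -/
def PxC (Q : Set (ℂ × ℂ)) : Prop :=
  ∃ (N : ℕ) (ρ : ℂ → ℂ), 1 ≤ N ∧ AnalyticAt ℂ ρ 0 ∧ ρ 0 = 0 ∧ ∃ᶠ s in 𝓝[≠] (0 : ℂ), (s ^ N, ρ s) ∈ Q

/-- The Puiseux statement in degree d. -/
def PxS (d : ℕ) : Prop :=
  ∀ (G : ℂ × ℂ → ℂ) (u : ℂ → ℂ) (Q : Set (ℂ × ℂ)), HolZ G → AnalyticAt ℂ u 0 → u 0 ≠ 0 →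
    (∀ᶠ z in 𝓝 (0 : ℂ), G (0, z) = z ^ d * u z) →
    (∃ᶠ p in 𝓝 (0 : ℂ × ℂ), p.1 ≠ 0 ∧ G p = 0 ∧ p ∈ Q) → PxC Q

theorem mpol_mult (d : ℕ) (hd : 1 ≤ d) (a : ℕ → ℂ) (htop : a (d - 1) = 0)
    (hne : ∃ j < d, a j ≠ 0) (w0 : ℂ) :
    ∃ e < d, ∃ u : ℂ → ℂ, AnalyticAt ℂ u 0 ∧ u 0 ≠ 0 ∧ ∀ w, mpol d a (w0 + w) = w ^ e * u w := by
  let p : Polynomial ℂ := Polynomial.X ^ d + ∑ j ∈ Finset.range d, Polynomial.C (a j) * Polynomial.X ^ j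
  have hp : ∀ z, p.eval z = mpol d a z := by
    intro z; simp [p, mpol, Polynomial.eval_finsetSum]
  have hcoef : ∀ j < d, p.coeff j = a j := by
    intro j hj
    have : d ≠ j := by omega
    simp [p, Polynomial.coeff_X_pow, hj, this.symm]
  have hlow : (∑ j ∈ Finset.range d, Polynomial.C (a j) * Polynomial.X ^ j).degree < (d : WithBot ℕ) := by
    rw [Polynomial.degree_lt_iff_coeff_zero]
    intro m hm
    have : ¬ m < d := by omega
    simp [Polynomial.coeff_X_pow, this]
  have hmon : p.Monic := Polynomial.monic_X_pow_add hlow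
  have hdeg : p.natDegree = d := by
    have : p.degree = d := by
      rw [Polynomial.degree_add_eq_left_of_degree_lt] <;> rw [Polynomial.degree_X_pow]
      exact hlow
    exact Polynomial.natDegree_eq_of_degree_eq_some this
  obtain ⟨r, hr, hnd⟩ := Polynomial.exists_eq_pow_rootMultiplicity_mul_and_not_dvd p hmon.ne_zero w0
  set e := p.rootMultiplicity w0 with he
  have hrmon : r.Monic := by
    have : ((Polynomial.X - Polynomial.C w0) ^ e).Monic := (Polynomial.monic_X_sub_C w0).pow e
    exact this.of_mul_monic_left (hr ▸ hmon)
  have hdeg2 : d = e + r.natDegree := by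
    rw [← hdeg, hr, Polynomial.Monic.natDegree_mul ((Polynomial.monic_X_sub_C w0).pow e) hrmon]
    simp
  have hed : e < d := by
    rcases Nat.lt_or_ge e d with h | h
    · exact h
    exfalso
    have hr0 : r.natDegree = 0 := by omega
    have hr1 : r = 1 := hrmon.natDegree_eq_zero.1 hr0
    have hed : e = d := by omega
    rw [hr1, mul_one, hed] at hr
    have h1 : p.coeff (d - 1) = 0 := by rw [hcoef _ (by omega), htop]
    have hw : w0 = 0 := by
      have h2 := Polynomial.coeff_X_add_C_pow (-w0) d (d - 1)
      rw [map_neg, ← sub_eq_add_neg] at h2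
      rw [← hr, h1, show d - (d - 1) = 1 by omega, Nat.choose_symm_of_eq_add (b := 1) (by omega)] at h2
      rw [Nat.choose_one_right] at h2
      have hdn : (d : ℂ) ≠ 0 := by exact_mod_cast (by omega : d ≠ 0)
      simpa [hdn] using h2
    obtain ⟨j, hj, hj0⟩ := hne
    apply hj0
    rw [← hcoef j hj, hr, hw]
    have : j ≠ d := by omega
    simp [Polynomial.coeff_X_pow, this]
  refine ⟨e, hed, fun w => r.eval (w0 + w), ?_, ?_, ?_⟩
  · have : Differentiable ℂ (fun w => r.eval (w0 + w)) := r.differentiable.comp (by fun_prop)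
    exact this.analyticAt 0
  · simp only [add_zero]
    intro h
    exact hnd (Polynomial.dvd_iff_isRoot.2 h)
  · intro w
    rw [← hp, hr]
    simp

theorem px_t (d : ℕ) (hd : 1 ≤ d) (IH : ∀ e < d, PxS e) (c : ℕ → ℂ → ℂ)
    (hc : ∀ j, AnalyticAt ℂ (c j) 0) (hc0 : ∀ j < d, c j 0 = 0) (htop : ∀ t, c (d - 1) t = 0)
    (Q : Set (ℂ × ℂ))
    (hfr : ∃ᶠ p in 𝓝 (0 : ℂ × ℂ), p.1 ≠ 0 ∧ mpol d (fun j => c j p.1) p.2 = 0 ∧ p ∈ Q) : PxC Q := by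
  have hfst : Tendsto (Prod.fst : ℂ × ℂ → ℂ) (𝓝 0) (𝓝 0) := continuous_fst.tendsto' _ _ rfl
  by_cases hne : ∃ j < d, ¬ ∀ᶠ t in 𝓝 (0 : ℂ), c j t = 0
  swap
  · push Not at hne
    refine ⟨1, fun _ => 0, le_rfl, analyticAt_const, rfl, ?_⟩
    intro hcon
    apply hfr
    rw [eventually_nhdsWithin_iff] at hcon
    have hall : ∀ᶠ t in 𝓝 (0 : ℂ), ∀ j ∈ Finset.range d, c j t = 0 :=
      (Finset.eventually_all _).2 fun j hj => hne j (Finset.mem_range.1 hj)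
    filter_upwards [hfst.eventually hcon, hfst.eventually hall] with p h1 h2
    rintro ⟨h3, h4, h5⟩
    apply h1 h3
    unfold mpol at h4
    rw [Finset.sum_eq_zero (fun j hj => by simp only [h2 j hj, zero_mul]), add_zero] at h4
    have h6 : p.2 = 0 := pow_eq_zero_iff (by omega) |>.1 h4
    rw [pow_one, ← h6]; exact h5
  obtain ⟨q, p, c', hq, hp, hc', ⟨j0, hj0, hj0'⟩, hz, hid⟩ := newton hc hc0 hne
  have hidall : ∀ᶠ s in 𝓝 (0 : ℂ), ∀ j ∈ Finset.range d,
      c j (s ^ q) * s ^ (p * j) = s ^ (p * d) * c' j s :=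
    (Finset.eventually_all _).2 fun j hj => hid j (Finset.mem_range.1 hj)
  have hscale : ∀ᶠ s in 𝓝 (0 : ℂ), ∀ w, mpol d (fun j => c j (s ^ q)) (s ^ p * w) =
      s ^ (p * d) * mpol d (fun j => c' j s) w := by
    filter_upwards [hidall] with s hs w
    unfold mpol
    rw [mul_add, mul_pow, ← pow_mul, Finset.mul_sum]
    congr 1
    refine Finset.sum_congr rfl fun j hj => ?_
    rw [mul_pow, ← pow_mul, ← mul_assoc, hs j hj, mul_assoc]
  set A : ℝ := ∑ j ∈ Finset.range d, ‖c' j 0‖ + 1 with hA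
  have hbd : ∀ᶠ s in 𝓝 (0 : ℂ), ∑ j ∈ Finset.range d, ‖c' j s‖ < A := by
    have hcont : ContinuousAt (fun s => ∑ j ∈ Finset.range d, ‖c' j s‖) 0 :=
      tendsto_finsetSum _ fun j _ => (hc' j).continuousAt.norm
    exact hcont.eventually_lt_const (by simp [hA])
  let B : ℂ → ℂ → Prop := fun s w => s ≠ 0 ∧ mpol d (fun j => c' j s) w = 0 ∧ (s ^ q, s ^ p * w) ∈ Q
  obtain ⟨w0, hw0⟩ : ∃ w0 : ℂ, ∃ᶠ x in 𝓝 ((0 : ℂ), w0), B x.1 x.2 := by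
    by_contra hcon
    push Not at hcon
    have hcpt : ∀ᶠ s in 𝓝 (0 : ℂ), ∀ w ∈ closedBall (0 : ℂ) (1 + A), ¬ B s w :=
      (isCompact_closedBall (0 : ℂ) (1 + A)).eventually_forall_of_forall_eventually
        (fun w _ => hcon w)
    obtain ⟨ε, hε, hball⟩ := Metric.eventually_nhds_iff_ball.1 (hcpt.and (hscale.and hbd))
    apply hfr
    have hsmall : ∀ᶠ x in 𝓝 (0 : ℂ × ℂ), ‖x.1‖ < ε ^ q := by
      have : ∀ᶠ t in 𝓝 (0 : ℂ), ‖t‖ < ε ^ q := by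
        have := ball_mem_nhds (0 : ℂ) (pow_pos hε q)
        filter_upwards [this] with t ht
        simpa using ht
      exact hfst.eventually this
    filter_upwards [hsmall] with x hx
    rintro ⟨h1, h2, h3⟩
    obtain ⟨s, hs⟩ := IsAlgClosed.exists_pow_nat_eq x.1 (show 0 < q by omega)
    have hs0 : s ≠ 0 := by
      rintro rfl
      rw [zero_pow (by omega)] at hs
      exact h1 hs.symm
    have hsε : ‖s‖ < ε := by
      rw [← hs, norm_pow] at hx
      exact lt_of_pow_lt_pow_left₀ q hε.le hx
    obtain ⟨b1, b2, b3⟩ := hball s (by simpa using hsε)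
    have hsp : s ^ p ≠ 0 := pow_ne_zero _ hs0
    have hx2 : s ^ p * (x.2 / s ^ p) = x.2 := by field_simp
    have hroot : mpol d (fun j => c' j s) (x.2 / s ^ p) = 0 := by
      have := b2 (x.2 / s ^ p)
      rw [hx2, hs, h2] at this
      exact (mul_eq_zero.1 this.symm).resolve_left (pow_ne_zero _ hs0)
    refine b1 (x.2 / s ^ p) ?_ ⟨hs0, hroot, ?_⟩
    · have := root_bound hd b3.le hroot
      simpa using this
    · rw [hx2, hs]; exact h3
  obtain ⟨e, he, u, hu, hu0, hmu⟩ := mpol_mult d hd (fun j => c' j 0)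
    (hz _ (Eventually.of_forall htop)) ⟨j0, hj0, hj0'⟩ w0
  let G : ℂ × ℂ → ℂ := fun x => mpol d (fun j => c' j x.1) (w0 + x.2)
  have hG : HolZ G := by
    have hall : ∀ᶠ s in 𝓝 (0 : ℂ), ∀ j ∈ Finset.range d, DifferentiableAt ℂ (c' j) s :=
      (Finset.eventually_all _).2 fun j _ => (hc' j).holZ
    filter_upwards [hfst.eventually hall] with x hx
    have : ∀ j ∈ Finset.range d, DifferentiableAt ℂ (fun y : ℂ × ℂ => c' j y.1) x := fun j hj =>
      DifferentiableAt.comp x (g := c' j) (f := Prod.fst) (hx j hj) (by fun_prop)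
    refine DifferentiableAt.add (by fun_prop) (DifferentiableAt.fun_sum fun j hj => ?_)
    exact (this j hj).mul (by fun_prop)
  obtain ⟨N, ρ, hN, hρ, hρ0, hρf⟩ := IH e he G u {x | (x.1 ^ q, x.1 ^ p * (w0 + x.2)) ∈ Q} hG hu hu0
    (Eventually.of_forall fun z => hmu z) (by
      have ht : Tendsto (fun x : ℂ × ℂ => (x.1, x.2 - w0)) (𝓝 (0, w0)) (𝓝 0) :=
        (by fun_prop : Continuous (fun x : ℂ × ℂ => (x.1, x.2 - w0))).tendsto' _ _ (by simp)
      refine ht.frequently (hw0.mono ?_)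
      rintro x ⟨h1, h2, h3⟩
      refine ⟨h1, ?_, ?_⟩
      · simpa [G] using h2
      · simpa using h3)
  refine ⟨N * q, fun s => s ^ (N * p) * (w0 + ρ s), Nat.mul_pos hN hq, ?_, ?_, ?_⟩
  · exact (analyticAt_id.pow _).mul (analyticAt_const.add hρ)
  · have : N * p ≠ 0 := (Nat.mul_pos hN hp).ne'
    simp [this]
  · refine hρf.mono fun s hs => ?_
    simp only [mem_ofPred_eq, ← pow_mul] at hs
    exact hs

theorem puiseux (d : ℕ) : PxS d := by
  induction d using Nat.strong_induction_on with
  | _ d IH =>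
    intro G u Q hG hu hu0 hGu hfr
    obtain ⟨k, c, hk, hc, hk0, hc0, heq⟩ := wprep hG hu hu0 hGu
    have hfr2 : ∃ᶠ p in 𝓝 (0 : ℂ × ℂ), p.1 ≠ 0 ∧ mpol d (fun j => c j p.1) p.2 = 0 ∧ p ∈ Q := by
      refine (hfr.and_eventually heq).mono ?_
      rintro p ⟨⟨h1, h2, h3⟩, h4⟩
      refine ⟨h1, ?_, h3⟩
      unfold mpol
      rw [h4, h2, mul_zero]
    rcases Nat.eq_zero_or_pos d with hd | hd
    · exfalso
      obtain ⟨p, hp⟩ := hfr2.exists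
      subst hd
      simp [mpol] at hp
    have hca : ∀ j, AnalyticAt ℂ (c j) 0 := fun j => (hc j).analyticAt
    let b : ℂ → ℂ := fun t => - c (d - 1) t / d
    have hb : AnalyticAt ℂ b 0 := (hca (d - 1)).neg.div analyticAt_const
      (by exact_mod_cast (by omega : d ≠ 0))
    have hb0 : b 0 = 0 := by simp [b, hc0 (d - 1) (by omega)]
    obtain ⟨N, ρ, hN, hρ, hρ0, hρf⟩ := px_t d hd IH (fun k t => shiftc d (fun j => c j t) (b t) k)
      (by
        intro k
        unfold shiftc
        refine ((hb.pow _).mul analyticAt_const).add ?_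
        refine Finset.analyticAt_fun_sum _ fun j _ => ?_
        exact (hca j).mul ((hb.pow _).mul analyticAt_const))
      (by
        intro j hj
        simp only [hb0]
        exact shiftc_zero d _ hc0 j hj)
      (fun t => shiftc_top d hd (fun j => c j t))
      {x | (x.1, x.2 + b x.1) ∈ Q}
      (by
        have ht : Tendsto (fun x : ℂ × ℂ => (x.1, x.2 - b x.1)) (𝓝 0) (𝓝 0) := by
          have hcont : ContinuousAt (fun x : ℂ × ℂ => (x.1, x.2 - b x.1)) 0 := by
            refine continuousAt_fst.prodMk (continuousAt_snd.sub ?_)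
            exact ContinuousAt.comp (f := Prod.fst) (g := b) hb.continuousAt continuousAt_fst
          have := hcont.tendsto
          have h00 : ((0 : ℂ × ℂ).1, (0 : ℂ × ℂ).2 - b (0 : ℂ × ℂ).1) = 0 := by simp [hb0]
          rwa [h00] at this
        refine ht.frequently (hfr2.mono ?_)
        rintro x ⟨h1, h2, h3⟩
        refine ⟨h1, ?_, ?_⟩
        · rw [← mpol_shift]
          simpa using h2
        · simpa using h3)
    refine ⟨N, fun s => ρ s + b (s ^ N), hN, ?_, ?_, hρf⟩
    · refine hρ.add (AnalyticAt.fun_comp (g := b) (f := fun s : ℂ => s ^ N) ?_ (analyticAt_id.pow _))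
      rw [zero_pow (by omega)]; exact hb
    · have : (0 : ℂ) ^ N = 0 := zero_pow (by omega)
      simp [hρ0, this, hb0]

end Loja

section Loja

theorem elim_C {R : Type} [CommRing R] {k : ℕ} (G : Fin k → Polynomial R) (h : Polynomial R)
    {i0 : Fin k} (hmon : (G i0).Monic) :
    ∃ T : Finset (PrimeSpectrum.BasicConstructibleSetData R),
      ∀ φ : R →+* ℂ, Function.Surjective φ →
        ((∃ z : ℂ, (∀ i, (G i).eval₂ φ z = 0) ∧ h.eval₂ φ z ≠ 0) ↔
          ∃ C ∈ T, (∀ i, φ (C.g i) = 0) ∧ φ C.f ≠ 0) := by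
  let B : PrimeSpectrum.BasicConstructibleSetData (Polynomial R) := ⟨h, k, G⟩
  have hB : Topology.IsConstructible B.toSet :=
    PrimeSpectrum.exists_constructibleSetData_iff.1 ⟨{B}, by
      simp [PrimeSpectrum.ConstructibleSetData.toSet]⟩
  obtain ⟨T, hT⟩ := PrimeSpectrum.exists_constructibleSetData_iff.2
    (PrimeSpectrum.isConstructible_comap_C hB)
  refine ⟨T, fun φ hφ => ?_⟩
  let x : PrimeSpectrum R := ⟨RingHom.ker φ, RingHom.ker_isPrime φ⟩
  have hx : (∃ C ∈ T, (∀ i, φ (C.g i) = 0) ∧ φ C.f ≠ 0) ↔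
      x ∈ PrimeSpectrum.ConstructibleSetData.toSet T := by
    simp only [PrimeSpectrum.ConstructibleSetData.toSet, mem_iUnion,
      PrimeSpectrum.BasicConstructibleSetData.toSet, Set.mem_sdiff, PrimeSpectrum.mem_zeroLocus,
      singleton_subset_iff, range_subset_iff, exists_prop]
    rfl
  rw [hx, hT]
  constructor
  · rintro ⟨z, h1, h2⟩
    let ψ : Polynomial R →+* ℂ := Polynomial.eval₂RingHom φ z
    refine ⟨⟨RingHom.ker ψ, RingHom.ker_isPrime ψ⟩, ?_, ?_⟩
    · simp only [PrimeSpectrum.BasicConstructibleSetData.toSet, Set.mem_sdiff,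
        PrimeSpectrum.mem_zeroLocus, singleton_subset_iff, range_subset_iff]
      exact ⟨h1, h2⟩
    · ext r
      simp [x, ψ, PrimeSpectrum.comap_asIdeal]
  · rintro ⟨q, hq, hqx⟩
    simp only [PrimeSpectrum.BasicConstructibleSetData.toSet, Set.mem_sdiff,
        PrimeSpectrum.mem_zeroLocus, singleton_subset_iff, range_subset_iff] at hq
    obtain ⟨hq1, hq2⟩ := hq
    have hC : ∀ r : R, Polynomial.C r ∈ q.asIdeal ↔ φ r = 0 := by
      intro r
      have : r ∈ (PrimeSpectrum.comap Polynomial.C q).asIdeal ↔ r ∈ x.asIdeal := by rw [hqx]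
      simpa [x] using this
    have hmap : ∀ p : Polynomial R, p.map φ = 0 → p ∈ q.asIdeal := by
      intro p hp
      rw [p.as_sum_range_C_mul_X_pow]
      refine Ideal.sum_mem _ fun i _ => Ideal.mul_mem_right _ _ ((hC _).2 ?_)
      rw [← Polynomial.coeff_map, hp, Polynomial.coeff_zero]
    choose ψ hψ using hφ
    have hs : ((G i0).map φ).Splits := IsAlgClosed.splits _
    have hprod : (((G i0).map φ).roots.map (fun a => Polynomial.X - Polynomial.C (ψ a))).prod
        ∈ q.asIdeal := by
      have h3 : G i0 - (((G i0).map φ).roots.map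
          (fun a => Polynomial.X - Polynomial.C (ψ a))).prod ∈ q.asIdeal := by
        apply hmap
        rw [Polynomial.map_sub, Polynomial.map_multiset_prod, Multiset.map_map]
        have h4 := hs.eq_prod_roots_of_monic (hmon.map φ)
        simp only [Function.comp_def, Polynomial.map_sub, Polynomial.map_X, Polynomial.map_C, hψ]
        rw [← h4, sub_self]
      have h5 := Ideal.sub_mem _ (show G i0 ∈ q.asIdeal from hq1 i0) h3
      simpa using h5
    rw [q.isPrime.multiset_prod_mem_iff_exists_mem] at hprod
    obtain ⟨p, hp, hpq⟩ := hprod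
    rw [Multiset.mem_map] at hp
    obtain ⟨a, -, rfl⟩ := hp
    have hev : ∀ p : Polynomial R, p ∈ q.asIdeal ↔ p.eval₂ φ a = 0 := by
      intro p
      have h6 : p - Polynomial.C (p.eval (ψ a)) ∈ q.asIdeal :=
        Ideal.mem_of_dvd _ (Polynomial.X_sub_C_dvd_sub_C_eval) hpq
      have h7 : p.eval₂ φ a = φ (p.eval (ψ a)) := by
        rw [← Polynomial.eval₂_hom, hψ]
      rw [h7, ← hC]
      exact ⟨fun h => by simpa using Ideal.sub_mem _ h h6, fun h => by simpa using Ideal.add_mem _ h6 h⟩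
    exact ⟨a, fun i => (hev _).1 (hq1 i), fun h => hq2 ((hev _).2 h)⟩

end Loja

section Loja

/-- Curve selection statement. -/
def CS (E : Type) [NormedAddCommGroup E] [NormedSpace ℂ E] : Prop :=
  ∀ (k : ℕ) (G : Fin k → E → ℂ) (h : E → ℂ), (∀ i, HolZ (G i)) → HolZ h →
    (∃ᶠ x in 𝓝 (0 : E), (∀ i, G i x = 0) ∧ h x ≠ 0) →
    ∃ γ : ℂ → E, AnalyticAt ℂ γ 0 ∧ γ 0 = 0 ∧
      ∀ᶠ t in 𝓝[≠] (0 : ℂ), (∀ i, G i (γ t) = 0) ∧ h (γ t) ≠ 0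

variable {E : Type} [NormedAddCommGroup E] [NormedSpace ℂ E]

theorem AnalyticAt.ev_diff {γ : ℂ → E} (hγ : AnalyticAt ℂ γ 0) [CompleteSpace E] :
    ∀ᶠ x in 𝓝 (0 : ℂ), DifferentiableAt ℂ γ x :=
  hγ.eventually_analyticAt.mono fun _ h => h.differentiableAt

theorem line_lemma {h : E → ℂ} (hh : HolZ h) (hf : ∃ᶠ x in 𝓝 (0 : E), h x ≠ 0) :
    ∃ v : E, ∀ᶠ t in 𝓝[≠] (0 : ℂ), h (t • v) ≠ 0 := by
  obtain ⟨R, hR, hball⟩ := Metric.eventually_nhds_iff_ball.1 hh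
  obtain ⟨x, hx, hxR⟩ := (hf.and_eventually (ball_mem_nhds (0 : E) hR)).exists
  refine ⟨x, ?_⟩
  let U : Set ℂ := {t | t • x ∈ ball (0 : E) R}
  have hUo : IsOpen U := isOpen_ball.preimage (by fun_prop : Continuous fun t : ℂ => t • x)
  have hUc : IsPreconnected U := by
    let _ : NormedSpace ℝ E := NormedSpace.restrictScalars ℝ ℂ E
    have : Convex ℝ U := by
      intro a ha b hb s t hs ht hst
      have h1 := convex_ball (0 : E) R ha hb hs ht hst
      have h2 : (s • a + t • b) • x = s • a • x + t • b • x := by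
        rw [add_smul, smul_assoc, smul_assoc]
      change (s • a + t • b) • x ∈ ball (0 : E) R
      rw [h2]; exact h1
    exact this.isPreconnected
  have hd : DifferentiableOn ℂ (fun t : ℂ => h (t • x)) U := fun t ht =>
    (DifferentiableAt.comp t (g := h) (f := fun t : ℂ => t • x) (hball _ ht)
      (by fun_prop)).differentiableWithinAt
  have han := hd.analyticOnNhd hUo
  have h0 : (0 : ℂ) ∈ U := by simp [U, hR]
  rcases (han 0 h0).eventually_eq_zero_or_eventually_ne_zero with h1 | h1
  · exfalso
    have := han.eqOn_zero_of_preconnected_of_eventuallyEq_zero hUc h0 h1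
    have h3 := this (x := 1) (by simpa [U] using hxR)
    simp at h3
    exact hx h3
  · exact h1

theorem freq_arc {k : ℕ} {G : Fin k → E → ℂ} {h : E → ℂ} (hG : ∀ i, HolZ (G i)) (hh : HolZ h)
    {γ : ℂ → E} (hγ : ∀ᶠ x in 𝓝 (0 : ℂ), DifferentiableAt ℂ γ x) (h0 : γ 0 = 0)
    (hf : ∃ᶠ t in 𝓝[≠] (0 : ℂ), (∀ i, G i (γ t) = 0) ∧ h (γ t) ≠ 0) :
    ∀ᶠ t in 𝓝[≠] (0 : ℂ), (∀ i, G i (γ t) = 0) ∧ h (γ t) ≠ 0 := by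
  have h1 : ∀ᶠ t in 𝓝[≠] (0 : ℂ), ∀ i, G i (γ t) = 0 := by
    rw [eventually_all]
    intro i
    have ha := ((hG i).comp' hγ h0).analyticAt
    exact (ha.frequently_zero_iff_eventually_zero.1 (hf.mono fun t ht => ht.1 i)).filter_mono
      nhdsWithin_le_nhds
  have h2 : ∀ᶠ t in 𝓝[≠] (0 : ℂ), h (γ t) ≠ 0 := by
    have ha := (hh.comp' hγ h0).analyticAt
    rcases ha.eventually_eq_zero_or_eventually_ne_zero with h3 | h3
    · exact absurd (h3.filter_mono nhdsWithin_le_nhds)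
        (fun h4 => hf (h4.mono fun t ht ht' => ht'.2 ht))
    · exact h3
  exact h1.and h2

/-- Polynomial over holomorphic germs with given coefficients. -/
noncomputable def hpol (d : ℕ) (c : ℕ → holAlg E) : Polynomial (holAlg E) :=
  ∑ j ∈ Finset.range d, Polynomial.C (c j) * Polynomial.X ^ j

/-- Evaluation at a point. -/
def hev (y : E) : holAlg E →+* ℂ := (Pi.evalRingHom (fun _ : E => ℂ) y).comp (holAlg E).val.toRingHom

theorem hev_apply (y : E) (f : holAlg E) : hev y f = f.1 y := rfl

theorem hev_surj (y : E) : Function.Surjective (hev y) := fun z =>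
  ⟨algebraMap ℂ (holAlg E) z, rfl⟩

theorem hpol_eval (d : ℕ) (c : ℕ → holAlg E) (y : E) (z : ℂ) :
    (hpol d c).eval₂ (hev y) z = ∑ j ∈ Finset.range d, (c j).1 y * z ^ j := by
  simp [hpol, Polynomial.eval₂_finsetSum, hev_apply]

theorem hpol_monic (d : ℕ) (c : ℕ → holAlg E) [Nontrivial (holAlg E)] :
    (Polynomial.X ^ d + hpol d c).Monic := by
  apply Polynomial.monic_X_pow_add
  rw [Polynomial.degree_lt_iff_coeff_zero]
  intro m hm
  have : ¬ m < d := by omega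
  simp [hpol, Polynomial.coeff_X_pow, this]

theorem cs_step [FiniteDimensional ℂ E] (IH : CS E) {k : ℕ} {G : Fin k → E × ℂ → ℂ} {h : E × ℂ → ℂ}
    (hG : ∀ i, HolZ (G i)) (hh : HolZ h)
    (hf : ∃ᶠ x in 𝓝 (0 : E × ℂ), (∀ i, G i x = 0) ∧ h x ≠ 0)
    (i0 : Fin k) (hi0 : ¬ ∀ᶠ z in 𝓝 (0 : ℂ), G i0 (0, z) = 0) :
    ∃ γ : ℂ → E × ℂ, AnalyticAt ℂ γ 0 ∧ γ 0 = 0 ∧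
      ∀ᶠ t in 𝓝[≠] (0 : ℂ), (∀ i, G i (γ t) = 0) ∧ h (γ t) ≠ 0 := by
  have hslice : AnalyticAt ℂ (fun z => G i0 ((0 : E), z)) 0 :=
    ((hG i0).comp' (φ := fun z : ℂ => ((0 : E), z)) (Eventually.of_forall fun z => by fun_prop)
      rfl).analyticAt
  obtain ⟨d, u, hu, hu0, hgu'⟩ := hslice.exists_eventuallyEq_pow_smul_nonzero_iff.2 hi0
  have hgu : ∀ᶠ z in 𝓝 (0 : ℂ), G i0 (0, z) = z ^ d * u z := by simpa using hgu'
  obtain ⟨q, c, hq, hc, hq0, hc0, hP⟩ := wprep (hG i0) hu hu0 hgu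
  choose qi ci _ hci hPi using fun i => wdiv (hG i0) (hG i) hu hu0 hgu
  obtain ⟨qh, ch, _, hch, hPh⟩ := wdiv (hG i0) hh hu hu0 hgu
  have hqne : ∀ᶠ p in 𝓝 (0 : E × ℂ), q p ≠ 0 := hq.continuousAt.eventually_ne hq0
  -- near the origin the system is equivalent to the polynomial system
  have hequiv : ∀ᶠ p in 𝓝 (0 : E × ℂ), (((∀ i, G i p = 0) ∧ h p ≠ 0) ↔
      (mpol d (fun j => c j p.1) p.2 = 0 ∧
        (∀ i, ∑ j ∈ Finset.range d, ci i j p.1 * p.2 ^ j = 0) ∧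
        ∑ j ∈ Finset.range d, ch j p.1 * p.2 ^ j ≠ 0)) := by
    filter_upwards [hP, hqne, eventually_all.2 hPi, hPh] with p h1 h2 h3 h4
    have e1 : mpol d (fun j => c j p.1) p.2 = q p * G i0 p := h1
    rw [e1]
    constructor
    · rintro ⟨a, b⟩
      refine ⟨by rw [a i0, mul_zero], fun i => ?_, ?_⟩
      · have := h3 i
        rw [a i, a i0, mul_zero, zero_add] at this
        exact this.symm
      · rw [h4, a i0, mul_zero, zero_add] at b
        exact b
    · rintro ⟨a, b, e⟩
      have a' : G i0 p = 0 := (mul_eq_zero.1 a).resolve_left h2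
      refine ⟨fun i => ?_, ?_⟩
      · rw [h3 i, a', mul_zero, zero_add, b i]
      · rw [h4, a', mul_zero, zero_add]; exact e
  have : Nontrivial (holAlg E) := (hev (0 : E)).domain_nontrivial
  let PP : Fin (k + 1) → Polynomial (holAlg E) :=
    Fin.cons (Polynomial.X ^ d + hpol d (fun j => ⟨c j, hc j⟩))
      (fun i => hpol d (fun j => ⟨ci i j, hci i j⟩))
  have hPP : ∀ y z, ((∀ i, (PP i).eval₂ (hev y) z = 0) ∧
      (hpol d (fun j => (⟨ch j, hch j⟩ : holAlg E))).eval₂ (hev y) z ≠ 0) ↔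
      (mpol d (fun j => c j y) z = 0 ∧
        (∀ i, ∑ j ∈ Finset.range d, ci i j y * z ^ j = 0) ∧
        ∑ j ∈ Finset.range d, ch j y * z ^ j ≠ 0) := by
    intro y z
    rw [Fin.forall_fin_succ, and_assoc]
    simp only [PP, Fin.cons_zero, Fin.cons_succ, hpol_eval, Polynomial.eval₂_add,
      Polynomial.eval₂_X_pow, mpol]
  obtain ⟨T, hT⟩ := elim_C PP (hpol d (fun j => (⟨ch j, hch j⟩ : holAlg E))) (i0 := 0)
    (hpol_monic d (fun j => ⟨c j, hc j⟩))
  have hfst : Tendsto (Prod.fst : E × ℂ → E) (𝓝 0) (𝓝 0) := continuous_fst.tendsto' _ _ rfl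
  have hfy : ∃ᶠ y in 𝓝 (0 : E), ∃ C ∈ T, (∀ i, (C.g i).1 y = 0) ∧ C.f.1 y ≠ 0 := by
    refine hfst.frequently ((hf.and_eventually hequiv).mono ?_)
    rintro p ⟨h1, h2⟩
    exact (hT (hev p.1) (hev_surj _)).1 ⟨p.2, (hPP _ _).2 (h2.1 h1)⟩
  obtain ⟨C, hCT, hCf⟩ : ∃ C ∈ T, ∃ᶠ y in 𝓝 (0 : E), (∀ i, (C.g i).1 y = 0) ∧ C.f.1 y ≠ 0 := by
    by_contra hcon
    push Not at hcon
    apply hfy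
    have := (Finset.eventually_all T).2 hcon
    filter_upwards [this] with y hy
    rintro ⟨C, hC, h1⟩
    exact h1.2 (hy C hC h1.1)
  obtain ⟨γ, hγ, hγ0, hγe⟩ := IH C.n (fun i => (C.g i).1) C.f.1 (fun i => (C.g i).2) C.f.2 hCf
  have hγd : ∀ᶠ x in 𝓝 (0 : ℂ), DifferentiableAt ℂ γ x :=
    hγ.eventually_analyticAt.mono fun _ h => h.differentiableAt
  have hγt : Tendsto γ (𝓝 0) (𝓝 0) := by
    have := hγ.continuousAt.tendsto
    rwa [hγ0] at this
  have hroots : ∀ᶠ t in 𝓝[≠] (0 : ℂ), ∃ z, mpol d (fun j => c j (γ t)) z = 0 ∧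
        (∀ i, ∑ j ∈ Finset.range d, ci i j (γ t) * z ^ j = 0) ∧
        ∑ j ∈ Finset.range d, ch j (γ t) * z ^ j ≠ 0 := by
    filter_upwards [hγe] with t ht
    obtain ⟨z, hz⟩ := (hT (hev (γ t)) (hev_surj _)).2 ⟨C, hCT, ht⟩
    exact ⟨z, (hPP _ _).1 hz⟩
  let Q : Set (ℂ × ℂ) := {x | (∀ i, G i (γ x.1, x.2) = 0) ∧ h (γ x.1, x.2) ≠ 0}
  let G' : ℂ × ℂ → ℂ := fun x => mpol d (fun j => c j (γ x.1)) x.2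
  have hG' : HolZ G' := by
    have h1 : ∀ᶠ s in 𝓝 (0 : ℂ), ∀ j ∈ Finset.range d, DifferentiableAt ℂ (fun t => c j (γ t)) s :=
      (Finset.eventually_all _).2 fun j _ => (hc j).comp' hγd hγ0
    have hfst : Tendsto (Prod.fst : ℂ × ℂ → ℂ) (𝓝 0) (𝓝 0) := continuous_fst.tendsto' _ _ rfl
    filter_upwards [hfst.eventually h1] with x hx
    have : ∀ j ∈ Finset.range d, DifferentiableAt ℂ (fun y : ℂ × ℂ => c j (γ y.1)) x := fun j hj =>
      DifferentiableAt.comp x (g := fun t => c j (γ t)) (f := Prod.fst) (hx j hj) (by fun_prop)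
    refine DifferentiableAt.add (by fun_prop) (DifferentiableAt.fun_sum fun j hj => ?_)
    exact (this j hj).mul (by fun_prop)
  have hpull : Tendsto (fun x : ℂ × ℂ => (γ x.1, x.2)) (𝓝 0) (𝓝 0) := by
    have h1 : Tendsto (fun x : ℂ × ℂ => γ x.1) (𝓝 0) (𝓝 0) :=
      hγt.comp (continuous_fst.tendsto' (0 : ℂ × ℂ) _ rfl)
    exact h1.prodMk_nhds (continuous_snd.tendsto' (0 : ℂ × ℂ) _ rfl)
  have hfrQ : ∃ᶠ p in 𝓝 (0 : ℂ × ℂ), p.1 ≠ 0 ∧ G' p = 0 ∧ p ∈ Q := by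
    intro hcon
    obtain ⟨η0, hη0, hball⟩ := Metric.eventually_nhds_iff_ball.1 (hcon.and (hpull.eventually hequiv))
    set η := min η0 1 with hηdef
    have hη : 0 < η := lt_min hη0 one_pos
    have hsum : ∀ᶠ t in 𝓝 (0 : ℂ), ∑ j ∈ Finset.range d, ‖c j (γ t)‖ < η ^ d := by
      have hcont : ContinuousAt (fun t => ∑ j ∈ Finset.range d, ‖c j (γ t)‖) 0 :=
        tendsto_finsetSum _ fun j _ => ((hc j).comp' hγd hγ0).continuousAt.norm
      refine hcont.eventually_lt_const ?_
      beta_reduce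
      rw [Finset.sum_eq_zero]
      · positivity
      · intro j hj
        rw [hγ0, hc0 j (Finset.mem_range.1 hj), norm_zero]
    have hall := ((hroots.and (hsum.filter_mono nhdsWithin_le_nhds)).and
      (mem_nhdsWithin_of_mem_nhds (ball_mem_nhds (0 : ℂ) hη) :
        ∀ᶠ t in 𝓝[≠] (0 : ℂ), t ∈ ball (0 : ℂ) η)).and
      (self_mem_nhdsWithin : ∀ᶠ t in 𝓝[≠] (0 : ℂ), t ∈ ({0}ᶜ : Set ℂ))
    obtain ⟨t, ⟨⟨⟨z, hz⟩, ht2⟩, ht3⟩, ht4⟩ := hall.exists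
    have hzη : ‖z‖ < η := root_small hη (min_le_right _ _) ht2 hz.1
    have hmem : (t, z) ∈ ball (0 : ℂ × ℂ) η0 := by
      rw [mem_ball, Prod.dist_eq, max_lt_iff]
      refine ⟨lt_of_lt_of_le ht3 (min_le_left _ _), ?_⟩
      simpa using lt_of_lt_of_le hzη (min_le_left _ _)
    obtain ⟨b1, b2⟩ := hball _ hmem
    exact b1 ⟨ht4, hz.1, b2.2 hz⟩
  obtain ⟨N, ρ, hN, hρ, hρ0, hρf⟩ := puiseux d G' (fun _ => 1) Q hG' analyticAt_const one_ne_zero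
    (Eventually.of_forall fun z => by
      simp only [G', mpol, hγ0]
      rw [Finset.sum_eq_zero]
      · simp
      · intro j hj
        rw [hc0 j (Finset.mem_range.1 hj), zero_mul]) hfrQ
  have hpow : (0 : ℂ) ^ N = 0 := zero_pow (by omega)
  have hΓ : AnalyticAt ℂ (fun s => (γ (s ^ N), ρ s)) 0 := by
    refine AnalyticAt.prod (AnalyticAt.fun_comp (g := γ) (f := fun s : ℂ => s ^ N) ?_
      (analyticAt_id.pow _)) hρ
    rw [hpow]; exact hγ
  have hΓ0 : (γ ((0 : ℂ) ^ N), ρ 0) = 0 := by rw [hpow, hγ0, hρ0]; rfl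
  exact ⟨_, hΓ, hΓ0, freq_arc hG hh (hΓ.eventually_analyticAt.mono fun _ h => h.differentiableAt)
    hΓ0 hρf⟩

theorem cs_all (n : ℕ) : ∀ (F : Type) [NormedAddCommGroup F] [NormedSpace ℂ F]
    [FiniteDimensional ℂ F], Module.finrank ℂ F = n → CS F := by
  induction n with
  | zero =>
    intro F _ _ _ hF k G h hG hh hf
    have : Subsingleton F := Module.finrank_zero_iff.1 hF
    obtain ⟨x, hx⟩ := hf.exists
    refine ⟨fun _ => 0, analyticAt_const, rfl, Eventually.of_forall fun t => ?_⟩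
    rwa [Subsingleton.elim x 0] at hx
  | succ n ih =>
    intro F _ _ _ hF k G h hG hh hf
    by_cases hall : ∀ i, ∀ᶠ x in 𝓝 (0 : F), G i x = 0
    · obtain ⟨v, hv⟩ := line_lemma hh (hf.mono fun x hx => hx.2)
      refine ⟨fun t => t • v, by fun_prop, by simp, ?_⟩
      have ht : Tendsto (fun t : ℂ => t • v) (𝓝[≠] 0) (𝓝 0) :=
        ((by fun_prop : Continuous fun t : ℂ => t • v).tendsto' 0 0 (by simp)).mono_left
          nhdsWithin_le_nhds
      exact (eventually_all.2 fun i => ht.eventually (hall i)).and hv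
    · push Not at hall
      obtain ⟨i0, hi0⟩ := hall
      obtain ⟨v, hv⟩ := line_lemma (hG i0) hi0
      have hv0 : v ≠ 0 := by
        rintro rfl
        simp only [smul_zero] at hv
        obtain ⟨t, ht⟩ := hv.exists
        have hcl : G i0 0 = 0 := by
          by_contra hne
          have := (hG i0).continuousAt.eventually_ne hne
          exact hf (this.mono fun x hx hx' => hx (hx'.1 i0))
        exact ht hcl
      let e0 : ((Fin n → ℂ) × ℂ) ≃L[ℂ] F := ContinuousLinearEquiv.ofFinrankEq (by simp [hF])
      obtain ⟨A, hA⟩ := SeparatingDual.exists_continuousLinearEquiv_apply_eq (R := ℂ)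
        (x := e0 (0, 1)) (y := v) (by simp) hv0
      let L : ((Fin n → ℂ) × ℂ) ≃L[ℂ] F := e0.trans A
      have hL : ∀ z : ℂ, L (0, z) = z • v := by
        intro z
        have : ((0 : Fin n → ℂ), z) = z • ((0 : Fin n → ℂ), (1 : ℂ)) := by simp
        rw [this, map_smul]
        simp [L, hA]
      have hLd : ∀ᶠ x in 𝓝 (0 : (Fin n → ℂ) × ℂ), DifferentiableAt ℂ L x :=
        Eventually.of_forall fun x => L.differentiableAt
      have hLs : Tendsto L.symm (𝓝 0) (𝓝 0) := L.symm.continuous.tendsto' _ _ (by simp)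
      obtain ⟨γ, hγ, hγ0, hγe⟩ := cs_step (ih (Fin n → ℂ) (by simp))
        (G := fun i x => G i (L x)) (h := fun x => h (L x))
        (fun i => (hG i).comp' hLd (by simp)) (hh.comp' hLd (by simp))
        (hLs.frequently (hf.mono fun x hx => by simpa using hx)) i0 (by
          intro hcon
          have h1 := hv.and (hcon.filter_mono nhdsWithin_le_nhds)
          obtain ⟨t, h2, h3⟩ := h1.exists
          rw [hL] at h3
          exact h2 h3)
      refine ⟨fun t => L (γ t), ?_, by simp [hγ0], hγe⟩
      exact AnalyticAt.fun_comp (g := L) (L.toContinuousLinearMap.analyticAt _) hγ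

end Loja

section Loja

theorem HolZ.pderiv {E : Type} [NormedAddCommGroup E] [NormedSpace ℂ E] [FiniteDimensional ℂ E]
    {F : E → ℂ} (hF : HolZ F) (v : E) : HolZ (fun z => fderiv ℂ F z v) := by
  have hh : HolZ (fun p : E × ℂ => F (p.1 + p.2 • v)) :=
    HolZ.comp' hF (φ := fun p : E × ℂ => p.1 + p.2 • v)
      (Eventually.of_forall fun p => by fun_prop) (by simp)
  have hb : ∀ᶠ p : E × ℂ in 𝓝 0, ‖F (p.1 + p.2 • v)‖ < ‖F 0‖ + 1 := by
    have := hh.continuousAt.norm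
    have h2 := this.eventually_lt (g := fun _ => ‖F 0‖ + 1) continuousAt_const (by simp)
    exact h2
  obtain ⟨ε, hε, hball⟩ := Metric.eventually_nhds_iff_ball.1 (hh.and hb)
  have hpr : ball (0 : E) ε ×ˢ ball (0 : ℂ) ε = ball (0 : E × ℂ) ε := ball_prod_same 0 0 ε
  have key := ldel_diff (R := ε) (ρ := ε) (M := ‖F 0‖ + 1) (h := fun p : E × ℂ => F (p.1 + p.2 • v))
    (fun p hp => (hball p (hpr ▸ hp)).1.differentiableWithinAt)
    (fun p hp => (hball p (hpr ▸ hp)).2.le)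
  rw [hpr] at key
  have h0 : HolZ (ldel (fun p : E × ℂ => F (p.1 + p.2 • v))) := by
    filter_upwards [ball_mem_nhds (0 : E × ℂ) hε] with p hp
    exact key.differentiableAt (isOpen_ball.mem_nhds hp)
  have h1 := HolZ.comp' h0 (φ := fun z : E => (z, (0 : ℂ)))
      (Eventually.of_forall fun p => by fun_prop) (by simp)
  have heq : (fun z => fderiv ℂ F z v) =ᶠ[𝓝 0]
      fun z => ldel (fun p : E × ℂ => F (p.1 + p.2 • v)) (z, 0) := by
    filter_upwards [hF] with z hz
    simp only [ldel, dslope_same]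
    have hl : HasDerivAt (fun t : ℂ => z + t • v) v 0 := by
      simpa using ((hasDerivAt_id (0 : ℂ)).smul_const v).const_add z
    have hz' : HasFDerivAt F (fderiv ℂ F z) (z + (0 : ℂ) • v) := by
      simpa using hz.hasFDerivAt
    exact (hz'.comp_hasDerivAt (0 : ℂ) hl).deriv.symm
  filter_upwards [h1, heq.eventuallyEq_nhds] with z hz hz2
  exact hz.congr_of_eventuallyEq hz2

theorem complexify {n : ℕ} {f : EuclideanSpace ℝ (Fin n) → ℝ} (hf : AnalyticAt ℝ f 0) :
    ∃ F : (Fin n → ℂ) → ℂ, HolZ F ∧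
      ∀ᶠ x in 𝓝 (0 : EuclideanSpace ℝ (Fin n)), F (fun i => (x i : ℂ)) = (f x : ℂ) := by
  obtain ⟨p, hp⟩ := hf
  obtain ⟨r, hr0, hrr⟩ := ENNReal.lt_iff_exists_nnreal_btwn.1 hp.radius_pos
  have hr : (0 : ℝ) < r := by exact_mod_cast hr0
  obtain ⟨C, hC, hpC⟩ := p.norm_mul_pow_le_of_lt_radius hrr
  let e : Fin n → EuclideanSpace ℝ (Fin n) := fun i => EuclideanSpace.basisFun (Fin n) ℝ i
  have he : ∀ i, ‖e i‖ = 1 := fun i => (EuclideanSpace.basisFun (Fin n) ℝ).orthonormal.1 i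
  let Fk : ℕ → (Fin n → ℂ) → ℂ := fun k z =>
    ∑ i : Fin k → Fin n, ((p k (fun j => e (i j)) : ℝ) : ℂ) * ∏ j, z (i j)
  refine ⟨fun z => ∑' k, Fk k z, ?_, ?_⟩
  · have hR : 0 < (r : ℝ) / (2 * (n + 1)) := by positivity
    have key := loja_tsum (f := Fk) (u := fun k => C * (1 / 2) ^ k) hR
      (summable_geometric_two.mul_left C) ?_ ?_
    · filter_upwards [ball_mem_nhds (0 : Fin n → ℂ) (half_pos hR)] with x hx using key x hx
    · intro k
      apply Differentiable.differentiableOn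
      simp only [Fk]
      fun_prop
    · intro k z hz
      have hz' : ‖z‖ ≤ (r : ℝ) / (2 * (n + 1)) := by simpa using (mem_ball_zero_iff.1 hz).le
      have h1 : ∀ i : Fin k → Fin n, ‖((p k (fun j => e (i j)) : ℝ) : ℂ) * ∏ j, z (i j)‖
          ≤ ‖p k‖ * ((r : ℝ) / (2 * (n + 1))) ^ k := by
        intro i
        rw [norm_mul, Complex.norm_real, norm_prod]
        gcongr
        · have := (p k).le_opNorm (fun j => e (i j))
          simpa [he] using this
        · calc ∏ j, ‖z (i j)‖ ≤ ∏ j : Fin k, (r : ℝ) / (2 * (n + 1)) :=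
                Finset.prod_le_prod (fun _ _ => norm_nonneg _)
                  (fun j _ => (norm_le_pi_norm z _).trans hz')
            _ = _ := by rw [Finset.prod_const]; simp only [Finset.card_univ, Fintype.card_fin]
      calc ‖Fk k z‖ ≤ ∑ i : Fin k → Fin n, ‖p k‖ * ((r : ℝ) / (2 * (n + 1))) ^ k :=
            norm_sum_le_of_le _ fun i _ => h1 i
        _ = (n : ℝ) ^ k * (‖p k‖ * ((r : ℝ) / (2 * (n + 1))) ^ k) := by simp
        _ = (‖p k‖ * (r : ℝ) ^ k) * ((n : ℝ) / (2 * (n + 1))) ^ k := by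
            rw [div_pow, div_pow]; ring
        _ ≤ C * (1 / 2) ^ k := by
            refine mul_le_mul (hpC k) (pow_le_pow_left₀ (by positivity) ?_ k) (by positivity) hC.le
            rw [div_le_div_iff₀ (by positivity) (by positivity)]; linarith
  · filter_upwards [hp.eventually_hasSum] with x hx
    rw [zero_add] at hx
    have hs := (Complex.hasSum_ofReal.2 hx).tsum_eq
    rw [← hs]
    congr 1
    ext k
    have hxs : x = ∑ i, x i • e i := by
      conv_lhs => rw [← (EuclideanSpace.basisFun (Fin n) ℝ).sum_repr x]
      simp [e]
    have : p k (fun _ => x) = ∑ i : Fin k → Fin n, (∏ j, x (i j)) * p k (fun j => e (i j)) := by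
      conv_lhs => rw [hxs]
      rw [(p k).map_sum (fun (_ : Fin k) (i : Fin n) => x i • e i)]
      refine Finset.sum_congr rfl fun i _ => ?_
      rw [(p k).map_smul_univ (fun j => x (i j)) (fun j => e (i j)), smul_eq_mul]
    rw [this]
    simp only [Fk]
    push_cast
    exact Finset.sum_congr rfl fun i _ => mul_comm _ _

theorem complexify_deriv {n : ℕ} {f : EuclideanSpace ℝ (Fin n) → ℝ} (hf : AnalyticAt ℝ f 0)
    {F : (Fin n → ℂ) → ℂ} (hF : HolZ F)
    (h : ∀ᶠ x in 𝓝 (0 : EuclideanSpace ℝ (Fin n)), F (fun i => (x i : ℂ)) = (f x : ℂ)) (i : Fin n) :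
    ∀ᶠ x in 𝓝 (0 : EuclideanSpace ℝ (Fin n)), fderiv ℂ F (fun i => (x i : ℂ)) (Pi.single i 1) =
      ((fderiv ℝ f x (EuclideanSpace.single i 1) : ℝ) : ℂ) := by
  have hc : Continuous (fun x : EuclideanSpace ℝ (Fin n) => (fun i => (x i : ℂ) : Fin n → ℂ)) := by
    fun_prop
  have ht : Tendsto (fun x : EuclideanSpace ℝ (Fin n) => (fun i => (x i : ℂ) : Fin n → ℂ))
      (𝓝 0) (𝓝 0) := by
    have := hc.tendsto 0
    have h0 : (fun i => (((0 : EuclideanSpace ℝ (Fin n)) i : ℝ) : ℂ) : Fin n → ℂ) = 0 := by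
      ext i; simp
    rwa [h0] at this
  filter_upwards [ht.eventually hF, hf.eventually_analyticAt, h.eventually_nhds] with x h1 h2 h3
  have hl : HasDerivAt (fun t : ℂ => (fun i => (x i : ℂ)) + t • (Pi.single i 1 : Fin n → ℂ))
      (Pi.single i 1) ((0 : ℝ) : ℂ) := by
    simpa using ((hasDerivAt_id (0 : ℂ)).smul_const (Pi.single i 1 : Fin n → ℂ)).const_add
      (fun i => (x i : ℂ))
  have h1' : HasFDerivAt F (fderiv ℂ F (fun i => (x i : ℂ)))
      ((fun i => (x i : ℂ)) + ((0 : ℝ) : ℂ) • (Pi.single i 1 : Fin n → ℂ)) := by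
    simpa using h1.hasFDerivAt
  have d1 := (h1'.comp_hasDerivAt _ hl).comp_ofReal
  have hl2 : HasDerivAt (fun t : ℝ => x + t • (EuclideanSpace.single i (1 : ℝ)))
      (EuclideanSpace.single i 1) 0 := by
    simpa using ((hasDerivAt_id (0 : ℝ)).smul_const (EuclideanSpace.single i (1 : ℝ))).const_add x
  have h2' : HasFDerivAt f (fderiv ℝ f x)
      (x + (0 : ℝ) • (EuclideanSpace.single i (1 : ℝ))) := by
    simpa using h2.differentiableAt.hasFDerivAt
  have d2 := (h2'.comp_hasDerivAt _ hl2).ofReal_comp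
  have ht2 : Tendsto (fun t : ℝ => x + t • (EuclideanSpace.single i (1 : ℝ))) (𝓝 0) (𝓝 x) := by
    have := hl2.continuousAt.tendsto
    simpa using this
  refine d1.unique (d2.congr_of_eventuallyEq ?_)
  filter_upwards [ht2.eventually h3] with t ht
  simp only [Function.comp]
  rw [← ht]
  congr 1
  ext j
  by_cases hj : j = i
  · subst hj; simp
  · simp [hj]

theorem log_contra {φ A : ℂ → ℂ} (hφ : AnalyticAt ℂ φ 0) (hA : ContinuousAt A 0) (h0 : φ 0 = 0)
    (h : ∀ᶠ t in 𝓝[≠] (0 : ℂ), φ t ≠ 0 ∧ deriv φ t = φ t * A t) : False := by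
  have hne : ¬ ∀ᶠ z in 𝓝 (0 : ℂ), φ z = 0 := by
    intro hz
    obtain ⟨t, ht, ht'⟩ := (h.and (hz.filter_mono nhdsWithin_le_nhds)).exists
    exact ht.1 ht'
  obtain ⟨k, u, hu, hu0, hk⟩ := hφ.exists_eventuallyEq_pow_smul_nonzero_iff.2 hne
  simp only [sub_zero, smul_eq_mul] at hk
  have hk0 : k ≠ 0 := by
    rintro rfl
    have := hk.self_of_nhds
    rw [h0] at this
    simp at this
    exact hu0 this.symm
  have heq : ∀ᶠ t in 𝓝[≠] (0 : ℂ), (k : ℂ) * u t + t * deriv u t - t * u t * A t = 0 := by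
    filter_upwards [h, self_mem_nhdsWithin, hk.eventually_nhds.filter_mono nhdsWithin_le_nhds,
      hu.eventually_analyticAt.filter_mono nhdsWithin_le_nhds] with t h1 h2 h3 h4
    have ht : t ≠ 0 := h2
    have hd : deriv φ t = (k : ℂ) * t ^ (k - 1) * u t + t ^ k * deriv u t := by
      have : φ =ᶠ[𝓝 t] fun z => z ^ k * u z := h3
      rw [this.deriv_eq]
      exact ((hasDerivAt_pow k t).mul h4.differentiableAt.hasDerivAt).deriv
    have h5 := h1.2
    rw [hd, h3.self_of_nhds] at h5
    have h6 : t ^ k = t ^ (k - 1) * t := by rw [← pow_succ]; congr 1; omega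
    rw [h6] at h5
    apply mul_left_cancel₀ (pow_ne_zero (k - 1) ht)
    linear_combination h5
  have hc : ContinuousAt (fun t => (k : ℂ) * u t + t * deriv u t - t * u t * A t) 0 := by
    have := hu.continuousAt
    have := hu.deriv.continuousAt
    fun_prop
  have h1 := hc.tendsto.mono_left (nhdsWithin_le_nhds (s := {0}ᶜ))
  have h2 := tendsto_nhds_unique h1 (tendsto_const_nhds.congr' (heq.mono fun t ht => ht.symm))
  simp at h2
  exact h2.elim hk0 hu0
end Loja

section Loja

theorem weak_loja {n : ℕ} {f : EuclideanSpace ℝ (Fin n) → ℝ} (hf : AnalyticAt ℝ f 0)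
    (hf0 : f 0 = 0) (C : ℝ) (hC : 0 < C) :
    ∀ᶠ x in 𝓝 (0 : EuclideanSpace ℝ (Fin n)), C * f x ^ 2 ≤ ‖fderiv ℝ f x‖ := by
  by_contra hcon
  have hfr : ∃ᶠ x in 𝓝 (0 : EuclideanSpace ℝ (Fin n)), ‖fderiv ℝ f x‖ < C * f x ^ 2 := by
    rw [Filter.not_eventually] at hcon
    exact hcon.mono fun x hx => not_le.1 hx
  obtain ⟨F, hF, hFf⟩ := complexify hf
  have hD := Filter.eventually_all.2 (complexify_deriv hf hF hFf)
  classical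
  let w : EuclideanSpace ℝ (Fin n) → Fin n → ℝ := fun x i =>
    if ‖fderiv ℝ f x‖ < C * f x ^ 2 then fderiv ℝ f x (EuclideanSpace.single i 1) / f x else 0
  have hw : ∀ x i, ‖((w x i : ℝ) : ℂ)‖ ≤ C * |f x| := by
    intro x i
    rw [Complex.norm_real, Real.norm_eq_abs]
    simp only [w]
    split_ifs with hx
    · have hfx : f x ≠ 0 := by
        intro h0
        rw [h0] at hx
        have := norm_nonneg (fderiv ℝ f x)
        norm_num at hx
        linarith
      have hfx' : 0 < |f x| := abs_pos.2 hfx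
      rw [abs_div, div_le_iff₀ hfx']
      have h1 := (fderiv ℝ f x).le_opNorm (EuclideanSpace.single i 1)
      simp only [EuclideanSpace.norm_single, norm_one, mul_one, Real.norm_eq_abs] at h1
      have : C * |f x| * |f x| = C * f x ^ 2 := by rw [mul_assoc, abs_mul_abs_self]; ring
      rw [this]
      exact h1.trans hx.le
    · rw [abs_zero]; positivity
  have hfc : Tendsto (fun x => C * |f x|) (𝓝 0) (𝓝 0) := by
    have := (hf.continuousAt.abs.const_mul C).tendsto
    simpa [hf0] using this
  have hc : Continuous (fun x : EuclideanSpace ℝ (Fin n) => (fun i => (x i : ℂ) : Fin n → ℂ)) := by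
    fun_prop
  have ht : Tendsto (fun x : EuclideanSpace ℝ (Fin n) => (fun i => (x i : ℂ) : Fin n → ℂ))
      (𝓝 0) (𝓝 0) := by
    have := hc.tendsto 0
    have h0 : (fun i => (((0 : EuclideanSpace ℝ (Fin n)) i : ℝ) : ℂ) : Fin n → ℂ) = 0 := by
      ext i; simp
    rwa [h0] at this
  have hwt : Tendsto (fun x => (fun i => ((w x i : ℝ) : ℂ) : Fin n → ℂ)) (𝓝 0) (𝓝 0) := by
    rw [tendsto_pi_nhds]
    intro i
    exact squeeze_zero_norm (fun x => hw x i) hfc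
  let ψ : EuclideanSpace ℝ (Fin n) → (Fin n → ℂ) × (Fin n → ℂ) :=
    fun x => ((fun i => (x i : ℂ)), (fun i => ((w x i : ℝ) : ℂ)))
  have hψ : Tendsto ψ (𝓝 0) (𝓝 0) := ht.prodMk_nhds hwt
  let G : Fin n → (Fin n → ℂ) × (Fin n → ℂ) → ℂ := fun i q =>
    fderiv ℂ F q.1 (Pi.single i 1) - F q.1 * q.2 i
  let h : (Fin n → ℂ) × (Fin n → ℂ) → ℂ := fun q => F q.1
  have hh : HolZ h := HolZ.comp' hF (φ := fun q : (Fin n → ℂ) × (Fin n → ℂ) => q.1)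
    (Eventually.of_forall fun p => by fun_prop) rfl
  have hG : ∀ i, HolZ (G i) := by
    intro i
    have h1 := HolZ.comp' (hF.pderiv (Pi.single i 1))
      (φ := fun q : (Fin n → ℂ) × (Fin n → ℂ) => q.1)
      (Eventually.of_forall fun p => by fun_prop) rfl
    filter_upwards [h1, hh] with q h1 h2
    have h3 : DifferentiableAt ℂ (fun q : (Fin n → ℂ) × (Fin n → ℂ) => q.2 i) q := by fun_prop
    exact h1.sub (h2.mul h3)
  have hfreq : ∃ᶠ q in 𝓝 (0 : (Fin n → ℂ) × (Fin n → ℂ)), (∀ i, G i q = 0) ∧ h q ≠ 0 := by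
    refine hψ.frequently ?_
    refine (hfr.and_eventually (hFf.and hD)).mono ?_
    rintro x ⟨hx, hx1, hx2⟩
    have hfx : f x ≠ 0 := by
      intro h0
      rw [h0] at hx
      have := norm_nonneg (fderiv ℝ f x)
      norm_num at hx
      linarith
    have hfx' : (f x : ℂ) ≠ 0 := by exact_mod_cast hfx
    constructor
    · intro i
      simp only [G, ψ, hx1, hx2 i, w, if_pos hx]
      push_cast
      field_simp
      ring
    · simp only [h, ψ, hx1]
      exact hfx'
  obtain ⟨γ, hγ, hγ0, hγe⟩ := cs_all _ ((Fin n → ℂ) × (Fin n → ℂ)) rfl n G h hG hh hfreq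
  have ha : AnalyticAt ℂ (fun t => (γ t).1) 0 := analyticAt_fst.comp hγ
  have hb : AnalyticAt ℂ (fun t => (γ t).2) 0 := analyticAt_snd.comp hγ
  have hγt : Tendsto (fun t => (γ t).1) (𝓝 0) (𝓝 0) := by
    have := ha.continuousAt.tendsto
    simpa [hγ0] using this
  have hφ : AnalyticAt ℂ (fun t => F (γ t).1) 0 := by
    apply HolZ.analyticAt
    exact HolZ.comp' hF (φ := fun t => (γ t).1)
      (ha.eventually_analyticAt.mono fun t ht => ht.differentiableAt) (by simp [hγ0])
  refine log_contra (A := fun t => ∑ i, (γ t).2 i * deriv (fun t => (γ t).1) t i) hφ ?_ ?_ ?_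
  · have h1 := hb.continuousAt
    have h2 := ha.deriv.continuousAt
    have h1' := continuousAt_pi.1 h1
    have h2' := continuousAt_pi.1 h2
    refine tendsto_finsetSum _ fun i _ => ?_
    exact (h1' i).mul (h2' i)
  · have := hFf.self_of_nhds
    simp only [hγ0, hf0] at this ⊢
    rw [Complex.ofReal_zero] at this
    rw [← this]
    congr 1
  · filter_upwards [hγe, (hγt.eventually hF).filter_mono nhdsWithin_le_nhds,
      ha.eventually_analyticAt.filter_mono nhdsWithin_le_nhds] with t h1 h2 h3
    refine ⟨h1.2, ?_⟩
    have hd := (h2.hasFDerivAt.comp_hasDerivAt t h3.differentiableAt.hasDerivAt).deriv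
    simp only [Function.comp_def] at hd
    rw [hd]
    have hs := LinearMap.pi_apply_eq_sum_univ (fderiv ℂ F (γ t).1 : (Fin n → ℂ) →ₗ[ℂ] ℂ)
      (deriv (fun t => (γ t).1) t)
    simp only [ContinuousLinearMap.coe_coe] at hs
    rw [hs, Finset.mul_sum]
    refine Finset.sum_congr rfl fun i _ => ?_
    have hi := sub_eq_zero.1 (h1.1 i)
    have he : (fun j => if i = j then (1 : ℂ) else 0) = Pi.single i 1 := by
      ext j
      simp [Pi.single_apply, eq_comm]
    rw [he, hi, smul_eq_mul]
    ring
end Loja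

section Loja

theorem norm_gradient_eq {n : ℕ} (f : EuclideanSpace ℝ (Fin n) → ℝ) (x : EuclideanSpace ℝ (Fin n)) :
    ‖gradient f x‖ = ‖fderiv ℝ f x‖ := by
  rw [gradient, LinearIsometryEquiv.norm_map]

theorem final_est {n : ℕ} (f p h : EuclideanSpace ℝ (Fin n) → ℝ) (r : ℕ)
    (hf : AnalyticAt ℝ f 0) (hf0 : f 0 = 0) (hh : AnalyticAt ℝ h 0)
    (hp : ∀ᶠ x in 𝓝 0, p x = h x * f x ^ (r + 2)) :
    ∀ᶠ x in 𝓝 0, |p x| ≤ ‖gradient f x‖ ∧ 3 * ‖gradient p x‖ ≤ 1 / 2 * ‖gradient f x‖ := by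
  obtain ⟨M, hM1, hMh, hMd⟩ : ∃ M : ℝ, 1 ≤ M ∧ |h 0| < M ∧ ‖fderiv ℝ h 0‖ < M :=
    ⟨|h 0| + ‖fderiv ℝ h 0‖ + 1, by
      have := abs_nonneg (h 0); have := norm_nonneg (fderiv ℝ h 0)
      refine ⟨by linarith, by linarith, by linarith⟩⟩
  have e1 : ∀ᶠ x in 𝓝 0, |h x| < M := hh.continuousAt.abs.eventually_lt continuousAt_const hMh
  have e2 : ∀ᶠ x in 𝓝 0, ‖fderiv ℝ h x‖ < M :=
    hh.fderiv.continuousAt.norm.eventually_lt continuousAt_const hMd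
  have e3 : ∀ᶠ x in 𝓝 0, |f x| < 1 / (12 * (r + 2) * M) :=
    hf.continuousAt.abs.eventually_lt continuousAt_const (by simp only [hf0, abs_zero]; positivity)
  have e3' : ∀ᶠ x in 𝓝 0, |f x| < 1 :=
    hf.continuousAt.abs.eventually_lt continuousAt_const (by simp [hf0])
  filter_upwards [e1, e2, e3, e3', weak_loja hf hf0 (12 * M) (by positivity), hp.eventually_nhds,
    hf.eventually_analyticAt, hh.eventually_analyticAt] with x h1 h2 h3 h3' h4 h5 h6 h7
  rw [norm_gradient_eq, norm_gradient_eq]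
  have hfsq : |f x| ^ 2 = f x ^ 2 := sq_abs _
  have hf2 : |f x| ^ (r + 2) ≤ f x ^ 2 := by
    rw [← hfsq]; exact pow_le_pow_of_le_one (abs_nonneg _) h3'.le (by omega)
  have hf1 : |f x| ^ (r + 1) ≤ |f x| := by
    conv_rhs => rw [← pow_one |f x|]
    exact pow_le_pow_of_le_one (abs_nonneg _) h3'.le (by omega)
  have hMf : M * f x ^ 2 ≤ 1 / 12 * ‖fderiv ℝ f x‖ := by linarith
  have hN := norm_nonneg (fderiv ℝ f x)
  constructor
  · rw [h5.self_of_nhds, abs_mul, abs_pow]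
    have : |h x| * |f x| ^ (r + 2) ≤ M * f x ^ 2 :=
      mul_le_mul h1.le hf2 (by positivity) (by positivity)
    linarith
  · have hpe : p =ᶠ[𝓝 x] fun y => h y * f y ^ (r + 2) := h5
    have hd := h7.differentiableAt.hasFDerivAt.mul (h6.differentiableAt.hasFDerivAt.pow (r + 2))
    have hd' : fderiv ℝ p x = h x • ((r + 2) * f x ^ (r + 1)) • fderiv ℝ f x
        + f x ^ (r + 2) • fderiv ℝ h x := by
      rw [hpe.fderiv_eq]
      refine hd.fderiv.trans ?_
      ext v
      simp
    have b : ‖fderiv ℝ p x‖ ≤ M * ((r + 2) * |f x|) * ‖fderiv ℝ f x‖ + f x ^ 2 * M := by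
      rw [hd']
      refine (norm_add_le _ _).trans (add_le_add ?_ ?_)
      · rw [norm_smul, norm_smul, ← mul_assoc, norm_mul, norm_pow, Real.norm_eq_abs,
          Real.norm_eq_abs, Real.norm_eq_abs, abs_of_nonneg (by positivity : (0 : ℝ) ≤ r + 2)]
        gcongr
      · rw [norm_smul, norm_pow, Real.norm_eq_abs]
        exact mul_le_mul hf2 h2.le (norm_nonneg _) (by positivity)
    have c : M * ((r + 2) * |f x|) ≤ 1 / 12 := by
      have := (lt_div_iff₀ (by positivity)).1 h3
      linarith
    have := mul_le_mul_of_nonneg_right c hN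
    linarith
end Loja

end LojaAll

/-- with `f` analytic, `f 0 = 0`, `∇f(0)=0`, `g − f ∈ (f)^{r+2}`, `r ≥ 1`,
there are a neighborhood `U` of `0`, `δ > 2` and `C₁, C₃ > 0` with
`C₃|∇F(ξ,x)| ≤ |∇f(x)| ≤ C₁|∇F(ξ,x)|` for `x ∈ U` and `|ξ| < δ`. -/
theorem stmt7 {n : ℕ} (f g : EuclideanSpace ℝ (Fin n) → ℝ) (r : ℕ) (hr : 1 ≤ r)
    (hf : AnalyticAt ℝ f 0) (hg : AnalyticAt ℝ g 0) (hf0 : f 0 = 0) (hg0 : g 0 = 0)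
    (hgrad : gradient f 0 = 0)
    (hmem : ∃ h : EuclideanSpace ℝ (Fin n) → ℝ, AnalyticAt ℝ h 0 ∧
      ∀ᶠ x in nhds 0, g x - f x = h x * f x ^ (r + 2)) :
    ∃ U ∈ nhds (0 : EuclideanSpace ℝ (Fin n)), ∃ δ > (2 : ℝ), ∃ C₁ > (0 : ℝ), ∃ C₃ > (0 : ℝ),
      ∀ x ∈ U, ∀ ξ : ℝ, |ξ| < δ →
        C₃ * nGradF f g ξ x ≤ ‖gradient f x‖ ∧ ‖gradient f x‖ ≤ C₁ * nGradF f g ξ x := by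
  obtain ⟨h, hh, hp⟩ := hmem
  have key := final_est f (fun y => g y - f y) h r hf hf0 hh hp
  refine ⟨_, key, 3, by norm_num, 2, by norm_num, 1 / 2, by norm_num, ?_⟩
  rintro x ⟨h1, h2⟩ ξ hξ
  have hN := norm_nonneg (gradient f x)
  have hξp : ‖ξ • gradient (fun y => g y - f y) x‖ ≤ 1 / 2 * ‖gradient f x‖ := by
    rw [norm_smul, Real.norm_eq_abs]
    exact (mul_le_mul_of_nonneg_right hξ.le (norm_nonneg _)).trans h2
  have hup := norm_add_le (gradient f x) (ξ • gradient (fun y => g y - f y) x)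
  have hlo := norm_sub_le (gradient f x + ξ • gradient (fun y => g y - f y) x)
    (ξ • gradient (fun y => g y - f y) x)
  rw [add_sub_cancel_right] at hlo
  have hp2 : (g x - f x) ^ 2 ≤ ‖gradient f x‖ ^ 2 := by
    rw [← sq_abs]
    exact pow_le_pow_left₀ (abs_nonneg _) h1 2
  unfold nGradF
  constructor
  · have : Real.sqrt ((g x - f x) ^ 2 + ‖gradient f x + ξ • gradient (fun y => g y - f y) x‖ ^ 2)
        ≤ 2 * ‖gradient f x‖ := by
      apply Real.sqrt_le_iff.2 ⟨by positivity, ?_⟩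
      have h3 : ‖gradient f x + ξ • gradient (fun y => g y - f y) x‖ ^ 2
          ≤ (3 / 2 * ‖gradient f x‖) ^ 2 :=
        pow_le_pow_left₀ (norm_nonneg _) (by linarith) 2
      nlinarith [sq_nonneg ‖gradient f x‖]
    linarith
  · have : ‖gradient f x + ξ • gradient (fun y => g y - f y) x‖ ≤
        Real.sqrt ((g x - f x) ^ 2 + ‖gradient f x + ξ • gradient (fun y => g y - f y) x‖ ^ 2) := by
      apply Real.le_sqrt_of_sq_le
      nlinarith [sq_nonneg (g x - f x)]
    linarith
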